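/- arXiv:1611.07900 — 5 statements merged into one kernel-verified Lean document; each statement's English description precedes it below -/
import Mathlib

section
/- The following three properties are mutually equivalent: (a) for every graded complement N (i.e., every ℂ-subspace N of P spanned by homogeneous polynomials with P = I ⊕ N as ℂ-vector spaces, I being the ideal generated by R₊), the ℂ-linear multiplication map R ⊗ N → P, r ⊗ h ↦ r·h, is injective (hence an isomorphism); (b) for some graded complement N the multiplication map R ⊗ N → P is injective; (c) P is free as an R-module. -/
open Matrix MvPolynomial TensorProduct

set_option synthInstance.maxHeartbeats 1000000

noncomputable section

/-- The substitution action of `g ∈ GL(m, ℂ)` on polynomials : `(g · f)(v) = f (g⁻¹ v)`. -/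
def pact (m : ℕ) (g : GL (Fin m) ℂ) :
    MvPolynomial (Fin m) ℂ →ₐ[ℂ] MvPolynomial (Fin m) ℂ :=
  MvPolynomial.aeval fun i =>
    ∑ j, ((g⁻¹ : GL (Fin m) ℂ) : Matrix (Fin m) (Fin m) ℂ) i j • MvPolynomial.X j

/-- `L` acts completely reducibly on `ℂᵐ`: every `L`-stable subspace has an `L`-stable
complement. -/
def CompletelyReducible (m : ℕ) (L : Subgroup (GL (Fin m) ℂ)) : Prop :=
  ∀ W : Submodule ℂ (Fin m → ℂ),
    (∀ g ∈ L, ∀ v ∈ W, (g : Matrix (Fin m) (Fin m) ℂ) *ᵥ v ∈ W) →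
    ∃ W' : Submodule ℂ (Fin m → ℂ),
      (∀ g ∈ L, ∀ v ∈ W', (g : Matrix (Fin m) (Fin m) ℂ) *ᵥ v ∈ W') ∧ IsCompl W W'

/-- `R = P^L`, the subalgebra of `L`-invariant polynomials. -/
def invR (m : ℕ) (L : Subgroup (GL (Fin m) ℂ)) : Subalgebra ℂ (MvPolynomial (Fin m) ℂ) where
  carrier := {f | ∀ g ∈ L, pact m g f = f}
  mul_mem' := fun ha hb g hg => by rw [_root_.map_mul, ha g hg, hb g hg]
  one_mem' := fun g hg => map_one (pact m g)
  add_mem' := fun ha hb g hg => by rw [_root_.map_add, ha g hg, hb g hg]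
  zero_mem' := fun g hg => map_zero (pact m g)
  algebraMap_mem' := fun r g hg => by
    simp only [MvPolynomial.algebraMap_eq]
    exact (pact m g).commutes r

/-- The ideal `I = P · R₊` generated by the invariants with zero constant term. -/
def idealI (m : ℕ) (L : Subgroup (GL (Fin m) ℂ)) : Ideal (MvPolynomial (Fin m) ℂ) :=
  Ideal.span {f | f ∈ invR m L ∧ MvPolynomial.constantCoeff f = 0}

/-- `N` is a graded complement: a subspace spanned by homogeneous polynomials with
`P = I ⊕ N` as `ℂ`-vector spaces. -/
def IsGradedComplement (m : ℕ) (L : Subgroup (GL (Fin m) ℂ))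
    (N : Submodule ℂ (MvPolynomial (Fin m) ℂ)) : Prop :=
  (∃ S : Set (MvPolynomial (Fin m) ℂ),
      (∀ f ∈ S, ∃ d : ℕ, f.IsHomogeneous d) ∧ N = Submodule.span ℂ S) ∧
    IsCompl (Submodule.restrictScalars ℂ (idealI m L)) N

/-- The multiplication map `R ⊗ N → P`, `r ⊗ h ↦ r * h`. -/
def mulMap (m : ℕ) (L : Subgroup (GL (Fin m) ℂ))
    (N : Submodule ℂ (MvPolynomial (Fin m) ℂ)) :
    (↥(invR m L) ⊗[ℂ] ↥N) →ₗ[ℂ] MvPolynomial (Fin m) ℂ :=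
  TensorProduct.lift
    (LinearMap.mk₂ ℂ (fun r h => (r : MvPolynomial (Fin m) ℂ) * (h : MvPolynomial (Fin m) ℂ))
      (fun r₁ r₂ h => by push_cast; ring)
      (fun c r h => by push_cast [smul_mul_assoc]; ring)
      (fun r h₁ h₂ => by push_cast; ring)
      (fun c r h => by push_cast [mul_smul_comm]; ring))

theorem pact_homog (m : ℕ) (g : GL (Fin m) ℂ) (p : MvPolynomial (Fin m) ℂ) (d : ℕ)
    (hp : p.IsHomogeneous d) : (pact m g p).IsHomogeneous d := by
  have := hp.aeval (n := 1) (fun i =>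
    ∑ j, ((g⁻¹ : GL (Fin m) ℂ) : Matrix (Fin m) (Fin m) ℂ) i j •
      (MvPolynomial.X j : MvPolynomial (Fin m) ℂ)) (fun i => by
      refine MvPolynomial.IsHomogeneous.sum _ _ _ (fun j _ => ?_)
      rw [MvPolynomial.smul_eq_C_mul]
      simpa using (MvPolynomial.isHomogeneous_C (Fin m) _).mul (MvPolynomial.isHomogeneous_X ℂ j))
  simpa [pact] using this

theorem pact_comp (m : ℕ) (g : GL (Fin m) ℂ) (p : MvPolynomial (Fin m) ℂ) (d : ℕ) :
    homogeneousComponent d (pact m g p) = pact m g (homogeneousComponent d p) := by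
  conv_lhs => rw [← MvPolynomial.sum_homogeneousComponent p]
  rw [map_sum, map_sum]
  have : ∀ i, homogeneousComponent d (pact m g (homogeneousComponent i p)) =
      if d = i then pact m g (homogeneousComponent i p) else 0 := fun i =>
    homogeneousComponent_of_mem (pact_homog m g _ i (homogeneousComponent_isHomogeneous i p))
  simp only [this, Finset.sum_ite_eq, Finset.mem_range]
  split_ifs with h
  · rfl
  · rw [homogeneousComponent_eq_zero _ _ (by omega), map_zero]

theorem invR_comp (m : ℕ) (L : Subgroup (GL (Fin m) ℂ)) (r : MvPolynomial (Fin m) ℂ)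
    (hr : r ∈ invR m L) (d : ℕ) : homogeneousComponent d r ∈ invR m L := by
  intro g hg
  rw [← pact_comp, hr g hg]

theorem homog_span_comp (m : ℕ) (S : Set (MvPolynomial (Fin m) ℂ))
    (hS : ∀ f ∈ S, ∃ d : ℕ, f.IsHomogeneous d) (n : MvPolynomial (Fin m) ℂ)
    (hn : n ∈ Submodule.span ℂ S) (d : ℕ) :
    homogeneousComponent d n ∈ Submodule.span ℂ S := by
  induction hn using Submodule.span_induction with
  | mem x hx =>
    obtain ⟨e, he⟩ := hS x hx
    rw [homogeneousComponent_of_mem he]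
    split_ifs
    · exact Submodule.subset_span hx
    · exact zero_mem _
  | zero => simp
  | add x y _ _ hx hy => rw [map_add]; exact add_mem hx hy
  | smul a x _ hx => rw [map_smul]; exact Submodule.smul_mem _ _ hx

theorem mulMap_tmul (m : ℕ) (L : Subgroup (GL (Fin m) ℂ))
    (N : Submodule ℂ (MvPolynomial (Fin m) ℂ)) (r : invR m L) (n : N) :
    mulMap m L N (r ⊗ₜ n) = (r : MvPolynomial (Fin m) ℂ) * n := rfl

theorem mulMap_smul (m : ℕ) (L : Subgroup (GL (Fin m) ℂ))
    (N : Submodule ℂ (MvPolynomial (Fin m) ℂ)) (r : invR m L) (x : (invR m L) ⊗[ℂ] N) :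
    mulMap m L N (r • x) = r • mulMap m L N x := by
  induction x using TensorProduct.induction_on with
  | zero => simp
  | tmul a n =>
    rw [TensorProduct.smul_tmul', mulMap_tmul, mulMap_tmul, Subalgebra.smul_def, smul_eq_mul,
      smul_eq_mul]
    push_cast
    ring
  | add a b ha hb => rw [smul_add, map_add, map_add, ha, hb, smul_add]

theorem mulMap_surj (m : ℕ) (L : Subgroup (GL (Fin m) ℂ))
    (N : Submodule ℂ (MvPolynomial (Fin m) ℂ)) (hN : IsGradedComplement m L N) :
    Function.Surjective (mulMap m L N) := by
  obtain ⟨⟨S, hS, rfl⟩, hc⟩ := hN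
  set N := Submodule.span ℂ S with hNdef
  have key : ∀ d : ℕ, ∀ f : MvPolynomial (Fin m) ℂ, f.IsHomogeneous d →
      f ∈ LinearMap.range (mulMap m L N) := by
    intro d
    induction d using Nat.strong_induction_on with
    | _ d ih =>
    intro f hf
    have hI : ∀ x ∈ idealI m L, ∀ p, homogeneousComponent d (p * x) ∈
        LinearMap.range (mulMap m L N) := by
      intro x hx
      unfold idealI at hx
      induction hx using Submodule.span_induction with
      | mem r hr =>
        intro p
        obtain ⟨hr1, hr0⟩ := hr
        rw [← MvPolynomial.sum_homogeneousComponent p, ← MvPolynomial.sum_homogeneousComponent r,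
          Finset.sum_mul_sum, map_sum]
        refine Submodule.sum_mem _ (fun i _ => ?_)
        rw [map_sum]
        refine Submodule.sum_mem _ (fun j _ => ?_)
        have hi := homogeneousComponent_isHomogeneous i p
        have hj := homogeneousComponent_isHomogeneous j r
        rw [homogeneousComponent_of_mem (hi.mul hj)]
        split_ifs with hd
        · rcases Nat.eq_zero_or_pos j with rfl | hjp
          · have : homogeneousComponent 0 r = 0 := by
              rw [homogeneousComponent_zero, ← constantCoeff_eq, hr0, map_zero]
            rw [this, mul_zero]
            exact zero_mem _
          · obtain ⟨t, ht⟩ := ih i (by omega) _ hi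
            refine ⟨(⟨_, invR_comp m L r hr1 j⟩ : invR m L) • t, ?_⟩
            rw [mulMap_smul, ht, Subalgebra.smul_def, smul_eq_mul, mul_comm]
        · exact zero_mem _
      | zero => intro p; simp
      | add x y _ _ hx hy =>
        intro p
        rw [mul_add, map_add]
        exact add_mem (hx p) (hy p)
      | smul a x _ hx =>
        intro p
        rw [smul_eq_mul, ← mul_assoc]
        exact hx _
    have hmem : f ∈ Submodule.restrictScalars ℂ (idealI m L) ⊔ N := by
      rw [hc.sup_eq_top]; trivial
    obtain ⟨x, hx, n, hn, rfl⟩ := Submodule.mem_sup.1 hmem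
    rw [← homogeneousComponent_eq_self hf, map_add]
    refine add_mem ?_ ?_
    · simpa using hI x hx 1
    · refine ⟨1 ⊗ₜ ⟨_, homog_span_comp m S hS n hn d⟩, ?_⟩
      rw [mulMap_tmul]
      simp
  intro f
  rw [← LinearMap.mem_range, ← MvPolynomial.sum_homogeneousComponent f]
  exact Submodule.sum_mem _ (fun i _ => key i _ (homogeneousComponent_isHomogeneous i f))

theorem exists_graded_compl (m : ℕ) (L : Subgroup (GL (Fin m) ℂ)) :
    ∃ N, IsGradedComplement m L N := by
  let J := Submodule.restrictScalars ℂ (idealI m L)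
  let b := MvPolynomial.basisMonomials (Fin m) ℂ
  obtain ⟨κ, a, -, hsp, hli⟩ := exists_linearIndependent' ℂ (fun i => J.mkQ (b i))
  refine ⟨Submodule.span ℂ (Set.range (fun k => b (a k))), ⟨_, ?_, rfl⟩, ?_⟩
  · rintro _ ⟨k, rfl⟩
    refine ⟨(a k).degree, ?_⟩
    simpa [b] using isHomogeneous_monomial (1 : ℂ) (rfl : (a k).degree = _)
  · change IsCompl J _
    constructor
    · rw [Submodule.disjoint_def]
      intro x hxJ hx
      obtain ⟨c, rfl⟩ := (Finsupp.mem_span_range_iff_exists_finsupp).1 hx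
      have h0 : J.mkQ (c.sum fun i r => r • b (a i)) = 0 := by
        rw [Submodule.mkQ_apply, Submodule.Quotient.mk_eq_zero]; exact hxJ
      have : c = 0 := by
        refine (linearIndependent_iff.1 hli) c ?_
        rw [Finsupp.linearCombination_apply, ← h0, map_finsuppSum]
        simp
      simp [this]
    · rw [codisjoint_iff, eq_top_iff]
      intro x _
      have hx : J.mkQ x ∈ Submodule.span ℂ (Set.range ((fun i => J.mkQ (b i)) ∘ a)) := by
        rw [hsp]
        have : Set.range (fun i => J.mkQ (b i)) = J.mkQ '' Set.range b := by
          rw [← Set.range_comp]; rfl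
        rw [this, Submodule.span_image, b.span_eq]
        exact ⟨x, trivial, rfl⟩
      obtain ⟨c, hc⟩ := (Finsupp.mem_span_range_iff_exists_finsupp).1 hx
      rw [Submodule.mem_sup]
      refine ⟨x - c.sum fun i r => r • b (a i), ?_, c.sum fun i r => r • b (a i), ?_, by simp⟩
      · rw [← Submodule.Quotient.mk_eq_zero, ← Submodule.mkQ_apply, map_sub, ← hc, map_finsuppSum]
        simp
      · exact (Finsupp.mem_span_range_iff_exists_finsupp).2 ⟨c, rfl⟩

set_option maxHeartbeats 2000000 in
theorem indep_of_free (m : ℕ) (L : Subgroup (GL (Fin m) ℂ))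
    (hF : Module.Free (invR m L) (MvPolynomial (Fin m) ℂ)) {ι : Type*} [Fintype ι] [DecidableEq ι]
    (h : ι → MvPolynomial (Fin m) ℂ)
    (hI : ∀ c : ι → ℂ, ∑ i, c i • h i ∈ idealI m L → c = 0)
    (r : ι → invR m L) (hr : ∑ i, r i • h i = 0) : r = 0 := by
  obtain ⟨k, a, y, h1, h2⟩ := Module.Flat.isTrivialRelation_of_sum_smul_eq_zero
    (R := invR m L) (M := MvPolynomial (Fin m) ℂ) (f := r) (x := h) hr
  let ε : invR m L →+* ℂ := (constantCoeff (σ := Fin m) (R := ℂ)).comp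
    (invR m L).val.toRingHom
  let A : Matrix ι (Fin k) (invR m L) := Matrix.of a
  let E : Matrix ι (Fin k) ℂ := A.map ε
  have hker : LinearMap.ker E.vecMulLinear = ⊥ := by
    rw [LinearMap.ker_eq_bot']
    intro c hc
    apply hI
    have e1 : ∑ i, c i • h i = ∑ j, ∑ i, c i • ((a i j : MvPolynomial (Fin m) ℂ) - C (ε (a i j)))
        * y j := by
      have e2 : ∀ j, ∑ i, c i * ε (a i j) = 0 := fun j => congrFun hc j
      have e3 : ∀ j, ∑ i, c i • ((a i j : MvPolynomial (Fin m) ℂ) - C (ε (a i j))) * y j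
          = ∑ i, c i • (a i j • y j) := by
        intro j
        have : ∑ i, c i • (C (ε (a i j)) * y j) = 0 := by
          simp_rw [← MvPolynomial.smul_eq_C_mul, smul_smul]
          rw [← Finset.sum_smul, e2, zero_smul]
        rw [← sub_zero (∑ i, c i • (a i j • y j)), ← this, ← Finset.sum_sub_distrib]
        refine Finset.sum_congr rfl (fun i _ => ?_)
        rw [← smul_sub, smul_mul_assoc, sub_mul]
        rfl
      simp_rw [e3]
      rw [Finset.sum_comm]
      refine Finset.sum_congr rfl (fun i _ => ?_)
      rw [h1 i, Finset.smul_sum]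
    rw [e1]
    refine Ideal.sum_mem _ (fun j _ => Ideal.sum_mem _ (fun i _ => ?_))
    rw [smul_mul_assoc, MvPolynomial.smul_eq_C_mul]
    refine Ideal.mul_mem_left _ _ (Ideal.mul_mem_right _ _ (Ideal.subset_span ⟨?_, ?_⟩))
    · exact sub_mem (a i j).2 ((invR m L).algebraMap_mem _)
    · simp [ε]
  obtain ⟨g, hg⟩ := LinearMap.exists_leftInverse_of_injective _ hker
  let B : Matrix (Fin k) ι ℂ := (LinearMap.toMatrix' g)ᵀ
  have hEB : E * B = 1 := by
    apply Matrix.vecMul_injective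
    funext v
    have hgv : g (v ᵥ* E) = v := LinearMap.congr_fun hg v
    change v ᵥ* (E * B) = v ᵥ* (1 : Matrix ι ι ℂ)
    rw [← Matrix.vecMul_vecMul, Matrix.vecMul_one, Matrix.vecMul_transpose,
      LinearMap.toMatrix'_mulVec, hgv]
  let B' : Matrix (Fin k) ι (invR m L) := B.map (algebraMap ℂ (invR m L))
  have hdet : (A * B').det ≠ 0 := by
    intro h0
    have h3 : ε (A * B').det = 1 := by
      rw [RingHom.map_det, RingHom.mapMatrix_apply, Matrix.map_mul]
      have : B'.map ε = B := by
        ext i j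
        simp only [B', Matrix.map_apply]
        exact constantCoeff_C _ _
      rw [this]
      change (E * B).det = 1
      rw [hEB, Matrix.det_one]
    rw [h0, map_zero] at h3
    exact zero_ne_one h3
  refine Matrix.eq_zero_of_vecMul_eq_zero hdet ?_
  have h4 : r ᵥ* A = 0 := funext h2
  rw [← Matrix.vecMul_vecMul, h4, Matrix.zero_vecMul]

theorem mulMap_inj (m : ℕ) (L : Subgroup (GL (Fin m) ℂ))
    (hF : Module.Free (invR m L) (MvPolynomial (Fin m) ℂ))
    (N : Submodule ℂ (MvPolynomial (Fin m) ℂ)) (hN : IsGradedComplement m L N) :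
    Function.Injective (mulMap m L N) := by
  classical
  rw [injective_iff_map_eq_zero]
  intro x hx
  let b := Module.Basis.ofVectorSpace ℂ N
  obtain ⟨c, rfl⟩ := (TensorProduct.equivFinsuppOfBasisRight (M := invR m L) b).symm.surjective x
  rw [TensorProduct.equivFinsuppOfBasisRight_symm_apply, map_finsuppSum] at hx
  have hr := indep_of_free m L hF (ι := c.support) (fun i => (b i : MvPolynomial (Fin m) ℂ)) ?_
    (fun i => c i) ?_
  · have : c = 0 := by
      ext1 i
      by_cases hi : i ∈ c.support
      · exact congrFun hr ⟨i, hi⟩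
      · simpa using hi
    rw [this, map_zero]
  · intro d hd
    have hz : (∑ i : c.support, d i • b i : N) = 0 := by
      apply Subtype.ext
      have hm : ((∑ i : c.support, d i • b i : N) : MvPolynomial (Fin m) ℂ) ∈ idealI m L := by
        push_cast; exact hd
      exact (Submodule.disjoint_def.1 hN.2.disjoint) _ hm (Subtype.property _)
    have hli := b.linearIndependent.comp (fun i : c.support => (i : _)) Subtype.val_injective
    funext i
    exact Fintype.linearIndependent_iff.1 hli d hz i
  · rw [← hx, Finsupp.sum]
    exact Finset.sum_coe_sort c.support (fun a => mulMap m L N (c a ⊗ₜ[ℂ] b a))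

theorem free_of_inj (m : ℕ) (L : Subgroup (GL (Fin m) ℂ))
    (N : Submodule ℂ (MvPolynomial (Fin m) ℂ)) (hN : IsGradedComplement m L N)
    (hi : Function.Injective (mulMap m L N)) :
    Module.Free (invR m L) (MvPolynomial (Fin m) ℂ) := by
  let f : ((invR m L) ⊗[ℂ] N) →ₗ[invR m L] MvPolynomial (Fin m) ℂ :=
    { toFun := mulMap m L N
      map_add' := map_add _
      map_smul' := mulMap_smul m L N }
  exact Module.Free.of_equiv (LinearEquiv.ofBijective f ⟨hi, mulMap_surj m L N hN⟩)

/-- (Kostant's Lemma 1) The following are mutually equivalent: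
(a) for every graded complement `N` the multiplication map `R ⊗ N → P` is injective;
(b) for some graded complement `N` it is injective;
(c) `P` is free as an `R`-module. -/
theorem statement7 (m : ℕ) (hm : 1 ≤ m) (L : Subgroup (GL (Fin m) ℂ))
    (hL : CompletelyReducible m L) :
    ((∀ N : Submodule ℂ (MvPolynomial (Fin m) ℂ), IsGradedComplement m L N →
        Function.Injective (mulMap m L N)) ↔
      Module.Free (invR m L) (MvPolynomial (Fin m) ℂ)) ∧
    ((∃ N : Submodule ℂ (MvPolynomial (Fin m) ℂ), IsGradedComplement m L N ∧
        Function.Injective (mulMap m L N)) ↔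
      Module.Free (invR m L) (MvPolynomial (Fin m) ℂ)) := by
  refine ⟨⟨fun h => ?_, fun hF N hN => mulMap_inj m L hF N hN⟩,
    ⟨fun ⟨N, hN, hi⟩ => free_of_inj m L N hN hi, fun hF => ?_⟩⟩
  · obtain ⟨N, hN⟩ := exists_graded_compl m L
    exact free_of_inj m L N hN (h N hN)
  · obtain ⟨N, hN⟩ := exists_graded_compl m L
    exact ⟨N, hN, mulMap_inj m L hF N hN⟩
end
end

section
/- For x ∈ sl(n+1,ℂ), the following are equivalent: (i) f(x) = 0 for every polynomial function f on sl(n+1,ℂ) with f(0) = 0 that is invariant under conjugation by K̃^ℂ (i.e., f(gxg⁻¹) = f(x) for all g ∈ K̃^ℂ); (ii) x is a nilpotent matrix and pr x is a nilpotent matrix. -/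
open Matrix

noncomputable section

/-- The block diagonal matrix `blockdiag (B, (det B)⁻¹)` in `M_{n+1}(ℂ)`. -/
def gmat (n : ℕ) (B : Matrix (Fin n) (Fin n) ℂ) : Matrix (Fin (n + 1)) (Fin (n + 1)) ℂ :=
  Matrix.of fun i j =>
    if hi : (i : ℕ) < n then
      (if hj : (j : ℕ) < n then B ⟨i, hi⟩ ⟨j, hj⟩ else 0)
    else if (j : ℕ) < n then 0 else (B.det)⁻¹

/-- The polynomial function on matrices attached to a polynomial `F` in the matrix
entries. -/
def evalF (n : ℕ) (F : MvPolynomial (Fin (n + 1) × Fin (n + 1)) ℂ)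
    (x : Matrix (Fin (n + 1)) (Fin (n + 1)) ℂ) : ℂ :=
  MvPolynomial.eval (fun p => x p.1 p.2) F

/-- The projection `pr x = [[X, 0], [0, d]]` of `x = [[X, a], [b, d]]` onto `k` along `p`. -/
def prMat (n : ℕ) (x : Matrix (Fin (n + 1)) (Fin (n + 1)) ℂ) :
    Matrix (Fin (n + 1)) (Fin (n + 1)) ℂ :=
  Matrix.of fun i j =>
    if i = Fin.last n then (if j = Fin.last n then x i j else 0)
    else (if j = Fin.last n then 0 else x i j)

theorem gmat_cc (n : ℕ) (B : Matrix (Fin n) (Fin n) ℂ) (i j : Fin n) :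
    gmat n B i.castSucc j.castSucc = B i j := by simp [gmat]
theorem gmat_cl (n : ℕ) (B : Matrix (Fin n) (Fin n) ℂ) (i : Fin n) :
    gmat n B i.castSucc (Fin.last n) = 0 := by simp [gmat]
theorem gmat_lc (n : ℕ) (B : Matrix (Fin n) (Fin n) ℂ) (i : Fin n) :
    gmat n B (Fin.last n) i.castSucc = 0 := by simp [gmat]
theorem gmat_ll (n : ℕ) (B : Matrix (Fin n) (Fin n) ℂ) :
    gmat n B (Fin.last n) (Fin.last n) = (B.det)⁻¹ := by simp [gmat]
theorem prMat_cc (n : ℕ) (x) (i j : Fin n) :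
    prMat n x i.castSucc j.castSucc = x i.castSucc j.castSucc := by
  simp [prMat, Fin.castSucc_ne_last]
theorem prMat_cl (n : ℕ) (x) (i : Fin n) :
    prMat n x i.castSucc (Fin.last n) = 0 := by simp [prMat, Fin.castSucc_ne_last]
theorem prMat_lc (n : ℕ) (x) (i : Fin n) :
    prMat n x (Fin.last n) i.castSucc = 0 := by simp [prMat, Fin.castSucc_ne_last]
theorem prMat_ll (n : ℕ) (x) :
    prMat n x (Fin.last n) (Fin.last n) = x (Fin.last n) (Fin.last n) := by simp [prMat]

theorem mat_ext (n : ℕ) {x y : Matrix (Fin (n+1)) (Fin (n+1)) ℂ}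
    (hcc : ∀ i j : Fin n, x i.castSucc j.castSucc = y i.castSucc j.castSucc)
    (hcl : ∀ i : Fin n, x i.castSucc (Fin.last n) = y i.castSucc (Fin.last n))
    (hlc : ∀ i : Fin n, x (Fin.last n) i.castSucc = y (Fin.last n) i.castSucc)
    (hll : x (Fin.last n) (Fin.last n) = y (Fin.last n) (Fin.last n)) : x = y := by
  ext i j
  refine Fin.lastCases ?_ (fun i => ?_) i <;> refine Fin.lastCases ?_ (fun j => ?_) j <;> simp [*]

theorem gmat_mul_inv (n : ℕ) (B C : Matrix (Fin n) (Fin n) ℂ) (h : B * C = 1) :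
    gmat n B * gmat n C = 1 := by
  have hd : B.det * C.det = 1 := by rw [← det_mul, h, det_one]
  apply mat_ext
  · intro i j
    simp only [mul_apply, Fin.sum_univ_castSucc, gmat_cc, gmat_cl, gmat_lc]
    have := congrFun (congrFun h i) j
    rw [mul_apply] at this
    rw [this]; simp [one_apply]
  · intro i
    simp [mul_apply, Fin.sum_univ_castSucc, gmat_cc, gmat_cl, gmat_lc, one_apply, Fin.castSucc_ne_last]
  · intro i
    simp [mul_apply, Fin.sum_univ_castSucc, gmat_cc, gmat_cl, gmat_lc, one_apply, (Fin.castSucc_ne_last _).symm]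
  · simp [mul_apply, Fin.sum_univ_castSucc, gmat_ll, gmat_cl, gmat_lc, ← mul_inv, hd]

theorem prMat_conj (n : ℕ) (B C : Matrix (Fin n) (Fin n) ℂ) (y) :
    prMat n (gmat n B * y * gmat n C) = gmat n B * prMat n y * gmat n C := by
  apply mat_ext <;> intros <;>
    simp [mul_apply, Fin.sum_univ_castSucc, gmat_cc, gmat_cl, gmat_lc, gmat_ll,
      prMat_cc, prMat_cl, prMat_lc, prMat_ll]

theorem nilp_of_coeff (m : ℕ) (x : Matrix (Fin m) (Fin m) ℂ)
    (h : ∀ k, k < m → x.charpoly.coeff k = 0) : IsNilpotent x := by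
  have : x.charpoly = Polynomial.X ^ m := by
    ext k
    rw [Polynomial.coeff_X_pow]
    rcases lt_trichotomy k m with hk | hk | hk
    · rw [h k hk, if_neg hk.ne]
    · subst hk
      have := x.charpoly_monic.coeff_natDegree
      rw [charpoly_natDegree_eq_dim, Fintype.card_fin] at this
      simp [this]
    · rw [if_neg hk.ne']
      apply Polynomial.coeff_eq_zero_of_natDegree_lt
      simpa using hk
  refine ⟨m, ?_⟩
  have h2 := aeval_self_charpoly x
  rw [this] at h2
  simpa using h2

theorem evalF_univ (n k : ℕ) (y) :
    evalF n ((charpoly.univ ℂ (Fin (n+1))).coeff k) y = y.charpoly.coeff k := by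
  have := charpoly.univ_coeff_eval₂Hom (Fin (n+1)) (RingHom.id ℂ) (fun p => y p.1 p.2) k
  exact this

def prF (n : ℕ) (F : MvPolynomial (Fin (n + 1) × Fin (n + 1)) ℂ) :
    MvPolynomial (Fin (n + 1) × Fin (n + 1)) ℂ :=
  MvPolynomial.bind₁ (fun p => if p.1 = Fin.last n then 
     (if p.2 = Fin.last n then MvPolynomial.X p else 0) else 
     (if p.2 = Fin.last n then 0 else MvPolynomial.X p)) F

theorem evalF_prF (n : ℕ) (F y) : evalF n (prF n F) y = evalF n F (prMat n y) := by
  induction F using MvPolynomial.induction_on with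
  | C a => simp [evalF, prF]
  | add p q hp hq =>
    simp only [evalF, prF, map_add] at *
    rw [hp, hq]
  | mul_X p i hp =>
    simp only [evalF, prF, map_mul, MvPolynomial.bind₁_X_right, MvPolynomial.eval_X] at *
    rw [hp]
    congr 1
    simp only [prMat, of_apply]
    split_ifs <;> simp

theorem conj_charpoly {m : ℕ} (g h y : Matrix (Fin m) (Fin m) ℂ) (H : g * h = 1) :
    (g * y * h).charpoly = y.charpoly := by
  rw [charpoly_mul_comm, ← mul_assoc, mul_eq_one_comm.mp H, one_mul]

theorem dir1 (n : ℕ) (x : Matrix (Fin (n + 1)) (Fin (n + 1)) ℂ)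
    (H : ∀ F : MvPolynomial (Fin (n + 1) × Fin (n + 1)) ℂ,
        MvPolynomial.eval (fun _ => (0 : ℂ)) F = 0 →
        (∀ B : GL (Fin n) ℂ, ∀ y : Matrix (Fin (n + 1)) (Fin (n + 1)) ℂ, y.trace = 0 →
          evalF n F (gmat n ↑B * y * gmat n ↑(B⁻¹)) = evalF n F y) →
        evalF n F x = 0) : IsNilpotent x ∧ IsNilpotent (prMat n x) := by
  have hg : ∀ B : GL (Fin n) ℂ, gmat n ↑B * gmat n ↑(B⁻¹) = 1 := fun B =>
    gmat_mul_inv n _ _ (by rw [← Units.val_mul]; simp)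
  have h0 : ∀ k < n + 1, evalF n ((charpoly.univ ℂ (Fin (n+1))).coeff k) 0 = 0 := by
    intro k hk
    rw [evalF_univ, charpoly_zero, Polynomial.coeff_X_pow, if_neg (by simpa using hk.ne)]
  constructor
  · refine nilp_of_coeff _ _ fun k hk => ?_
    rw [← evalF_univ]
    refine H _ (h0 k hk) fun B y _ => ?_
    rw [evalF_univ, evalF_univ, conj_charpoly _ _ _ (hg B)]
  · refine nilp_of_coeff _ _ fun k hk => ?_
    rw [← evalF_univ, ← evalF_prF]
    refine H _ ?_ fun B y _ => ?_
    · have := evalF_prF n ((charpoly.univ ℂ (Fin (n+1))).coeff k) 0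
      have h2 : prMat n 0 = 0 := by ext i j; simp [prMat]
      rw [h2, h0 k hk] at this
      exact this
    · rw [evalF_prF, evalF_prF, evalF_univ, evalF_univ, prMat_conj, conj_charpoly _ _ _ (hg B)]

/-- Squared Euclidean norm. -/
def qn {m : Type*} [Fintype m] (v : m → ℂ) : ℝ := ∑ i, ‖v i‖ ^ 2

theorem qn_nonneg {m : Type*} [Fintype m] (v : m → ℂ) : 0 ≤ qn v :=
  Finset.sum_nonneg fun _ _ => by positivity

theorem qn_eq_zero {m : Type*} [Fintype m] {v : m → ℂ} (h : qn v = 0) : v = 0 := by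
  funext i
  have := (Finset.sum_eq_zero_iff_of_nonneg (fun _ _ => by positivity)).1 h i (Finset.mem_univ i)
  simpa using this

theorem le_qn {m : Type*} [Fintype m] (v : m → ℂ) (i : m) : ‖v i‖ ^ 2 ≤ qn v :=
  Finset.single_le_sum (f := fun i => ‖v i‖ ^ 2) (fun _ _ => by positivity) (Finset.mem_univ i)

theorem qn_zero {m : Type*} [Fintype m] : qn (0 : m → ℂ) = 0 := by simp [qn]

theorem qn_single {m : Type*} [Fintype m] [DecidableEq m] (j : m) :
    qn (Pi.single j (1 : ℂ)) = 1 := by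
  unfold qn
  rw [Finset.sum_eq_single j]
  · simp
  · intro i _ hi; simp [hi]
  · simp

theorem quad_qn {m l : Type*} [Fintype m] [Fintype l] (M : Matrix m l ℂ) (u : l → ℂ) :
    star u ⬝ᵥ ((Mᴴ * M) *ᵥ u) = (qn (M *ᵥ u) : ℂ) := by
  rw [← mulVec_mulVec, dotProduct_mulVec, vecMul_conjTranspose, star_star]
  simp only [dotProduct, qn, Pi.star_apply, Complex.ofReal_sum]
  refine Finset.sum_congr rfl fun i _ => ?_
  rw [Complex.star_def, Complex.conj_mul']
  simp

open scoped MatrixOrder ComplexOrder in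
theorem chol {n : ℕ} (G : Matrix (Fin n) (Fin n) ℂ) (hG : G.PosSemidef) :
    ∃ C : Matrix (Fin n) (Fin n) ℂ, ∀ u, (qn (C *ᵥ u) : ℂ) = star u ⬝ᵥ (G *ᵥ u) := by
  obtain ⟨C, rfl⟩ := CStarAlgebra.nonneg_iff_eq_star_mul_self.mp hG.nonneg
  exact ⟨C, fun u => by rw [star_eq_conjTranspose, quad_qn]⟩

open scoped ComplexOrder in
theorem gram {n : ℕ} (X : Matrix (Fin n) (Fin n) ℂ) (b : Fin n → ℂ) (N : ℕ)
    (s r τ : ℝ) (hs : 0 ≤ s) (hr : 0 ≤ r) (hτ : 0 ≤ τ) :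
    ∃ C : Matrix (Fin n) (Fin n) ℂ, ∀ u, qn (C *ᵥ u) =
      ∑ k ∈ Finset.range N, τ ^ k * (s * qn (X ^ k *ᵥ u) + r * ‖b ⬝ᵥ (X ^ k *ᵥ u)‖ ^ 2) := by
  let R : Matrix Unit (Fin n) ℂ := replicateRow Unit b
  let G : Matrix (Fin n) (Fin n) ℂ := ∑ k ∈ Finset.range N,
    ((τ ^ k : ℝ) : ℂ) • ((s : ℂ) • ((X ^ k)ᴴ * X ^ k) + (r : ℂ) • ((R * X ^ k)ᴴ * (R * X ^ k)))
  have hG : G.PosSemidef := by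
    apply posSemidef_sum
    intro k _
    refine PosSemidef.smul (PosSemidef.add ?_ ?_) ?_
    · exact (posSemidef_conjTranspose_mul_self _).smul (by simpa using hs)
    · exact (posSemidef_conjTranspose_mul_self _).smul (by simpa using hr)
    · exact_mod_cast pow_nonneg hτ k
  obtain ⟨C, hC⟩ := chol G hG
  refine ⟨C, fun u => ?_⟩
  have h := hC u
  have hq : ∀ w : Fin n → ℂ, qn (R *ᵥ w) = ‖b ⬝ᵥ w‖ ^ 2 := by
    intro w; simp [qn, R, mulVec]
  have : star u ⬝ᵥ (G *ᵥ u) = ((∑ k ∈ Finset.range N, τ ^ k * (s * qn (X ^ k *ᵥ u) +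
      r * ‖b ⬝ᵥ (X ^ k *ᵥ u)‖ ^ 2) : ℝ) : ℂ) := by
    simp only [G, sum_mulVec, dotProduct_sum, smul_mulVec, add_mulVec, dotProduct_add,
      dotProduct_smul, quad_qn]
    rw [Complex.ofReal_sum]
    refine Finset.sum_congr rfl fun k _ => ?_
    rw [← mulVec_mulVec, hq]
    simp only [smul_eq_mul]
    push_cast
    rfl
  rw [this] at h
  exact_mod_cast h

theorem key {n : ℕ} (X : Matrix (Fin n) (Fin n) ℂ) (a b : Fin n → ℂ) (hX : IsNilpotent X)
    (hab : ∀ k, b ⬝ᵥ (X ^ k *ᵥ a) = 0) (ε : ℝ) (hε : 0 < ε) :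
    ∃ C : GL (Fin n) ℂ,
      (∀ u, qn ((C : Matrix (Fin n) (Fin n) ℂ) *ᵥ (X *ᵥ u)) ≤
        ε ^ 2 * qn ((C : Matrix (Fin n) (Fin n) ℂ) *ᵥ u)) ∧
      qn ((C : Matrix (Fin n) (Fin n) ℂ) *ᵥ a) ≤ ε ^ 2 ∧
      ∀ u, ‖b ⬝ᵥ u‖ ^ 2 ≤ ε ^ 2 * qn ((C : Matrix (Fin n) (Fin n) ℂ) *ᵥ u) := by
  obtain ⟨N, hN⟩ := hX
  set τ : ℝ := (ε ^ 2)⁻¹ with hτ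
  have hτ0 : 0 < τ := by positivity
  have hετ : ε ^ 2 * τ = 1 := by rw [hτ]; field_simp
  set S : ℝ := ∑ k ∈ Finset.range (N + 1), τ ^ k * qn (X ^ k *ᵥ a) with hS
  have hS0 : 0 ≤ S := Finset.sum_nonneg fun k _ => mul_nonneg (by positivity) (qn_nonneg _)
  set s : ℝ := ε ^ 2 / (1 + S) with hs
  have hs0 : 0 < s := by positivity
  obtain ⟨C, hC⟩ := gram X b (N + 1) s τ τ hs0.le hτ0.le hτ0.le
  have hf : ∀ w : Fin n → ℂ, 0 ≤ s * qn w + τ * ‖b ⬝ᵥ w‖ ^ 2 := fun w =>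
    add_nonneg (mul_nonneg hs0.le (qn_nonneg _)) (by positivity)
  have h0 : ∀ u, s * qn u + τ * ‖b ⬝ᵥ u‖ ^ 2 ≤ qn (C *ᵥ u) := by
    intro u
    rw [hC, Finset.sum_range_succ']
    have : 0 ≤ ∑ k ∈ Finset.range N, τ ^ (k + 1) * (s * qn (X ^ (k + 1) *ᵥ u) +
        τ * ‖b ⬝ᵥ (X ^ (k + 1) *ᵥ u)‖ ^ 2) :=
      Finset.sum_nonneg fun k _ => mul_nonneg (by positivity) (hf _)
    simp only [pow_zero, one_mulVec, one_mul]
    linarith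
  have hinj : Function.Injective C.mulVec := by
    intro u v huv
    have h1 : C *ᵥ (u - v) = 0 := by rw [mulVec_sub]; exact sub_eq_zero.2 huv
    have h2 := h0 (u - v)
    rw [h1, qn_zero] at h2
    have h3 : 0 ≤ τ * ‖b ⬝ᵥ (u - v)‖ ^ 2 := by positivity
    have h4 := qn_nonneg (u - v)
    have h5 : qn (u - v) = 0 := by nlinarith
    exact sub_eq_zero.1 (qn_eq_zero h5)
  have hu : IsUnit C := mulVec_injective_iff_isUnit.1 hinj
  obtain ⟨C, rfl⟩ := hu
  refine ⟨C, fun u => ?_, ?_, fun u => ?_⟩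
  · rw [hC, hC, Finset.sum_range_succ, Finset.sum_range_succ']
    have e : ∀ k, X ^ k *ᵥ (X *ᵥ u) = X ^ (k + 1) *ᵥ u := fun k => by
      rw [mulVec_mulVec, pow_succ]
    simp only [e]
    rw [pow_succ X N, hN, zero_mul, zero_mulVec, qn_zero, dotProduct_zero, mul_add (ε ^ 2), Finset.mul_sum]
    simp only [norm_zero, pow_zero, one_mulVec, one_mul]
    have h1 := mul_nonneg (sq_nonneg ε) (hf u)
    have h2 : ∀ k, ∀ z : ℝ, ε ^ 2 * (τ ^ (k + 1) * z) = τ ^ k * z := by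
      intro k z
      rw [pow_succ]
      linear_combination τ ^ k * z * hετ
    simp only [h2]
    simp
    linarith
  · rw [hC]
    have : ∑ k ∈ Finset.range (N + 1), τ ^ k * (s * qn (X ^ k *ᵥ a) +
        τ * ‖b ⬝ᵥ (X ^ k *ᵥ a)‖ ^ 2) = s * S := by
      rw [hS, Finset.mul_sum]
      refine Finset.sum_congr rfl fun k _ => ?_
      rw [hab]; simp; ring
    rw [this, hs, div_mul_eq_mul_div, div_le_iff₀ (by positivity)]
    nlinarith [sq_nonneg ε]
  · have h1 := h0 u
    have h2 := mul_nonneg hs0.le (qn_nonneg u)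
    have h3 : τ * ‖b ⬝ᵥ u‖ ^ 2 ≤ qn ((C : Matrix (Fin n) (Fin n) ℂ) *ᵥ u) := by linarith
    calc ‖b ⬝ᵥ u‖ ^ 2 = ε ^ 2 * (τ * ‖b ⬝ᵥ u‖ ^ 2) := by linear_combination -‖b ⬝ᵥ u‖ ^ 2 * hετ
      _ ≤ _ := by gcongr

theorem key2 {n : ℕ} (X : Matrix (Fin n) (Fin n) ℂ) (a b : Fin n → ℂ) (hX : IsNilpotent X)
    (hab : ∀ k, b ⬝ᵥ (X ^ k *ᵥ a) = 0) (ε : ℝ) (hε : 0 < ε) :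
    ∃ C : GL (Fin n) ℂ,
      (∀ i j, ‖(C.1 * X * C⁻¹.1) i j‖ ≤ ε) ∧ (∀ i, ‖(C.1 *ᵥ a) i‖ ≤ ε) ∧
      ∀ j, ‖(b ᵥ* C⁻¹.1) j‖ ≤ ε := by
  obtain ⟨C, h1, h2, h3⟩ := key X a b hX hab ε hε
  have hc : ∀ j, C.1 *ᵥ (C⁻¹.1 *ᵥ Pi.single j 1) = Pi.single j 1 := by
    intro j
    rw [mulVec_mulVec, ← Units.val_mul, mul_inv_cancel, Units.val_one, one_mulVec]
  refine ⟨C, fun i j => ?_, fun i => ?_, fun j => ?_⟩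
  · refine le_of_sq_le_sq ?_ hε.le
    have := h1 (C⁻¹.1 *ᵥ Pi.single j 1)
    rw [hc, qn_single, mul_one] at this
    refine le_trans ?_ this
    refine le_trans (le_of_eq ?_) (le_qn _ i)
    rw [mulVec_mulVec, mulVec_mulVec, mulVec_single_one, col_apply]
  · refine le_of_sq_le_sq ?_ hε.le
    exact (le_qn _ i).trans h2
  · refine le_of_sq_le_sq ?_ hε.le
    have := h3 (C⁻¹.1 *ᵥ Pi.single j 1)
    rw [hc, qn_single, mul_one, dotProduct_mulVec, dotProduct_single_one] at this
    exact this

theorem rescale {n : ℕ} (C : GL (Fin n) ℂ) : ∃ B : GL (Fin n) ℂ,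
    B.1.det • B.1 = C.1 ∧ (B⁻¹.1.det) • B⁻¹.1 = C⁻¹.1 := by
  have hd : C.1.det ≠ 0 := ((isUnit_iff_isUnit_det _).1 C.isUnit).ne_zero
  obtain ⟨t, ht⟩ := IsAlgClosed.exists_pow_nat_eq (C.1.det)⁻¹ (Nat.succ_pos n)
  have ht0 : t ≠ 0 := by
    rintro rfl
    rw [zero_pow (Nat.succ_ne_zero n)] at ht
    exact inv_ne_zero hd ht.symm
  have hdi : C⁻¹.1.det = (C.1.det)⁻¹ := by
    apply eq_inv_of_mul_eq_one_left
    rw [← det_mul, ← Units.val_mul]; simp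
  refine ⟨⟨t • C.1, t⁻¹ • C⁻¹.1, ?_, ?_⟩, ?_, ?_⟩
  · rw [smul_mul_smul_comm, mul_inv_cancel₀ ht0, ← Units.val_mul]; simp
  · rw [smul_mul_smul_comm, inv_mul_cancel₀ ht0, ← Units.val_mul]; simp
  · show (t • C.1).det • (t • C.1) = C.1
    rw [det_smul, smul_smul, Fintype.card_fin]
    have : t ^ n * C.1.det * t = 1 := by
      rw [mul_right_comm, ← pow_succ, ht, inv_mul_cancel₀ hd]
    rw [this, one_smul]
  · show (t⁻¹ • C⁻¹.1).det • (t⁻¹ • C⁻¹.1) = C⁻¹.1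
    rw [det_smul, smul_smul, Fintype.card_fin, hdi]
    have : t⁻¹ ^ n * (C.1.det)⁻¹ * t⁻¹ = 1 := by
      rw [mul_right_comm, ← pow_succ, inv_pow, ht, inv_inv, mul_inv_cancel₀ hd]
    rw [this, one_smul]

/-- Top-left block. -/
def blkX {n : ℕ} (x : Matrix (Fin (n + 1)) (Fin (n + 1)) ℂ) : Matrix (Fin n) (Fin n) ℂ :=
  Matrix.of fun i j => x i.castSucc j.castSucc
/-- Column block. -/
def blkA {n : ℕ} (x : Matrix (Fin (n + 1)) (Fin (n + 1)) ℂ) : Fin n → ℂ :=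
  fun i => x i.castSucc (Fin.last n)
/-- Row block. -/
def blkB {n : ℕ} (x : Matrix (Fin (n + 1)) (Fin (n + 1)) ℂ) : Fin n → ℂ :=
  fun i => x (Fin.last n) i.castSucc

theorem prMat_pow (n : ℕ) (x : Matrix (Fin (n + 1)) (Fin (n + 1)) ℂ) (k : ℕ) :
    (∀ i j : Fin n, (prMat n x ^ k) i.castSucc j.castSucc = (blkX x ^ k) i j) ∧
    (∀ i : Fin n, (prMat n x ^ k) i.castSucc (Fin.last n) = 0) ∧
    (∀ i : Fin n, (prMat n x ^ k) (Fin.last n) i.castSucc = 0) ∧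
    (prMat n x ^ k) (Fin.last n) (Fin.last n) = x (Fin.last n) (Fin.last n) ^ k := by
  induction k with
  | zero => simp [one_apply, Fin.castSucc_ne_last, (Fin.castSucc_ne_last _).symm]
  | succ k ih =>
    obtain ⟨h1, h2, h3, h4⟩ := ih
    simp [pow_succ, mul_apply, Fin.sum_univ_castSucc, h1, h2, h3, h4, prMat_cc, prMat_cl,
      prMat_lc, prMat_ll, blkX]

theorem bXa (n : ℕ) (x : Matrix (Fin (n + 1)) (Fin (n + 1)) ℂ) (hx : IsNilpotent x)
    (hX : IsNilpotent (blkX x)) (hd : x (Fin.last n) (Fin.last n) = 0) (k : ℕ) :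
    blkB x ⬝ᵥ (blkX x ^ k *ᵥ blkA x) = 0 := by
  obtain ⟨N, hN⟩ := hX
  obtain ⟨M, hM⟩ := hx
  set X := blkX x with hXd
  set a := blkA x with ha
  set b := blkB x with hb
  let p : Polynomial ℂ := 1 - Polynomial.X ^ 2 *
    ∑ k ∈ Finset.range N, Polynomial.C (b ⬝ᵥ (X ^ k *ᵥ a)) * Polynomial.X ^ k
  have hroot : ∀ z, ¬ p.IsRoot z := by
    intro z hz
    have hz' : 1 - z ^ 2 * ∑ k ∈ Finset.range N, (b ⬝ᵥ (X ^ k *ᵥ a)) * z ^ k = 0 := by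
      simpa [p, Polynomial.IsRoot, Polynomial.eval_finsetSum] using hz
    let g : ℕ → (Fin n → ℂ) := fun k => z ^ k • (X ^ k *ᵥ a)
    let u : Fin n → ℂ := z • ∑ k ∈ Finset.range N, g k
    have hu : z • (X *ᵥ u) + z • a = u := by
      have e : ∀ k, z • X *ᵥ g k = g (k + 1) := by
        intro k
        simp only [g, mulVec_smul, mulVec_mulVec, pow_succ' X, smul_smul, pow_succ' z]
      have e2 : z • (X *ᵥ ∑ k ∈ Finset.range N, g k) + a = ∑ k ∈ Finset.range N, g k := by
        have h1 := Finset.sum_range_succ g N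
        rw [Finset.sum_range_succ'] at h1
        have g0 : g 0 = a := by simp [g]
        have gN : g N = 0 := by simp [g, hN]
        rw [g0, gN, add_zero] at h1
        rw [mulVec_sum, Finset.smul_sum, ← h1]
        simp only [e]
      simp only [u]
      rw [mulVec_smul, ← smul_add, e2]
    have hbu : z * (b ⬝ᵥ u) = 1 := by
      have : b ⬝ᵥ u = z * ∑ k ∈ Finset.range N, (b ⬝ᵥ (X ^ k *ᵥ a)) * z ^ k := by
        simp only [u, g, dotProduct_smul, dotProduct_sum, smul_eq_mul]
        congr 1
        exact Finset.sum_congr rfl fun _ _ => mul_comm _ _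
      rw [this]
      linear_combination -hz'
    let v : Fin (n + 1) → ℂ := Fin.snoc u 1
    have hv : (z • x) *ᵥ v = v := by
      funext i
      refine Fin.lastCases ?_ (fun i => ?_) i
      · simp only [mulVec, dotProduct, Fin.sum_univ_castSucc, v, Fin.snoc_castSucc, Fin.snoc_last,
          Matrix.smul_apply, smul_eq_mul, hd, mul_zero, zero_mul, add_zero]
        rw [← hbu, dotProduct, Finset.mul_sum]
        exact Finset.sum_congr rfl fun _ _ => mul_assoc _ _ _
      · have := congrFun hu i
        simp only [mulVec, dotProduct, Fin.sum_univ_castSucc, v, Fin.snoc_castSucc, Fin.snoc_last,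
          Matrix.smul_apply, smul_eq_mul, mul_one]
        rw [← this]
        simp only [Pi.add_apply, Pi.smul_apply, smul_eq_mul, mulVec, dotProduct, Finset.mul_sum]
        congr 1
        exact Finset.sum_congr rfl fun _ _ => mul_assoc _ _ _
    have hpow : ∀ m, (z • x) ^ m *ᵥ v = v := by
      intro m
      induction m with
      | zero => simp
      | succ m ih => rw [pow_succ, ← mulVec_mulVec, hv, ih]
    have h1 := hpow M
    rw [smul_pow, hM, smul_zero, zero_mulVec] at h1
    have h2 := congrFun h1 (Fin.last n)
    simp [v] at h2
  have hdeg : p.degree = 0 := by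
    by_contra hne
    obtain ⟨z, hz⟩ := IsAlgClosed.exists_root p hne
    exact hroot z hz
  by_cases hk : k < N
  · have h1 : p.coeff (k + 2) = 0 := by
      apply Polynomial.coeff_eq_zero_of_degree_lt
      rw [hdeg]
      exact_mod_cast Nat.succ_pos _
    simp only [p, Polynomial.coeff_sub, Polynomial.coeff_X_pow_mul, Polynomial.finsetSum_coeff,
      Polynomial.coeff_C_mul_X_pow, Polynomial.coeff_one] at h1
    simpa [hk] using h1
  · have : X ^ k = 0 := pow_eq_zero_of_le (not_lt.1 hk) hN
    rw [this]; simp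

theorem dir2 (n : ℕ) (x : Matrix (Fin (n + 1)) (Fin (n + 1)) ℂ) (hx : x.trace = 0)
    (h1 : IsNilpotent x) (h2 : IsNilpotent (prMat n x))
    (F : MvPolynomial (Fin (n + 1) × Fin (n + 1)) ℂ)
    (h0 : MvPolynomial.eval (fun _ => (0 : ℂ)) F = 0)
    (hF : ∀ B : GL (Fin n) ℂ, ∀ y : Matrix (Fin (n + 1)) (Fin (n + 1)) ℂ, y.trace = 0 →
          evalF n F (gmat n ↑B * y * gmat n ↑(B⁻¹)) = evalF n F y) : evalF n F x = 0 := by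
  obtain ⟨N, hN⟩ := h2
  obtain ⟨p1, -, -, p4⟩ := prMat_pow n x N
  rw [hN] at p1 p4
  have hd : x (Fin.last n) (Fin.last n) = 0 := by
    have : x (Fin.last n) (Fin.last n) ^ N = 0 := p4.symm
    exact eq_zero_of_pow_eq_zero this
  have hX : IsNilpotent (blkX x) := ⟨N, by ext i j; exact (p1 i j).symm⟩
  have hab := bXa n x h1 hX hd
  have hcont : Continuous fun v : Fin (n + 1) × Fin (n + 1) → ℂ => MvPolynomial.eval v F :=
    MvPolynomial.continuous_eval F
  by_contra hne
  have hpos : 0 < ‖evalF n F x‖ := norm_pos_iff.2 hne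
  obtain ⟨δ, hδ, H⟩ := Metric.continuous_iff.1 hcont (fun _ => 0) _ hpos
  obtain ⟨C, c1, c2, c3⟩ := key2 _ _ _ hX hab (δ / 2) (by positivity)
  obtain ⟨B, b1, b2⟩ := rescale C
  have hdet : B.1.det * B⁻¹.1.det = 1 := by
    rw [← det_mul, ← Units.val_mul]; simp
  have hBi : (B.1.det)⁻¹ = B⁻¹.1.det := (eq_inv_of_mul_eq_one_right hdet).symm
  have hBi' : (B⁻¹.1.det)⁻¹ = B.1.det := (eq_inv_of_mul_eq_one_left hdet).symm
  have := H (fun p => (gmat n ↑B * x * gmat n ↑(B⁻¹)) p.1 p.2) ?_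
  · rw [h0, dist_zero_right] at this
    have e := hF B x hx
    unfold evalF at e this
    rw [e] at this
    exact lt_irrefl _ this
  · refine lt_of_le_of_lt ?_ (half_lt_self hδ)
    rw [dist_pi_le_iff (by positivity)]
    rintro ⟨i, j⟩
    rw [dist_zero_right]
    show ‖(gmat n ↑B * x * gmat n ↑(B⁻¹)) i j‖ ≤ δ / 2
    refine Fin.lastCases ?_ (fun i => ?_) i <;> refine Fin.lastCases ?_ (fun j => ?_) j
    · simp [mul_apply, Fin.sum_univ_castSucc, gmat_cl, gmat_lc, hd]
      positivity
    · refine le_trans (le_of_eq ?_) (c3 j)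
      rw [← b2]
      congr 1
      simp only [mul_apply, Fin.sum_univ_castSucc, gmat_cc, gmat_lc, gmat_ll, hBi, vecMul,
        dotProduct, Matrix.smul_apply, smul_eq_mul, blkB, zero_mul, mul_zero, Finset.sum_const_zero,
        zero_add, add_zero]
      exact Finset.sum_congr rfl fun _ _ => by ring
    · refine le_trans (le_of_eq ?_) (c2 i)
      rw [← b1]
      congr 1
      simp only [mul_apply, Fin.sum_univ_castSucc, gmat_cc, gmat_cl, gmat_ll, hBi', mulVec,
        dotProduct, Matrix.smul_apply, smul_eq_mul, blkA, zero_mul, mul_zero, Finset.sum_const_zero,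
        zero_add, add_zero, Finset.sum_mul]
      exact Finset.sum_congr rfl fun _ _ => by ring
    · refine le_trans (le_of_eq ?_) (c1 i j)
      have e : C.1 * blkX x * C⁻¹.1 = B.1 * blkX x * B⁻¹.1 := by
        rw [← b1, ← b2, smul_mul, Matrix.mul_smul, smul_mul, smul_smul, mul_comm, hdet, one_smul]
      rw [e]
      congr 1
      simp [mul_apply, Fin.sum_univ_castSucc, gmat_cc, gmat_cl, gmat_lc, blkX]

/-- For traceless `x ∈ sl(n+1, ℂ)`: every `K̃^ℂ`-conjugation-invariant
polynomial function vanishing at `0` vanishes at `x` iff `x` is nilpotent and `pr x` is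
nilpotent. -/
theorem statement10 (n : ℕ) (hn : 1 ≤ n)
    (x : Matrix (Fin (n + 1)) (Fin (n + 1)) ℂ) (hx : x.trace = 0) :
    (∀ F : MvPolynomial (Fin (n + 1) × Fin (n + 1)) ℂ,
        MvPolynomial.eval (fun _ => (0 : ℂ)) F = 0 →
        (∀ B : GL (Fin n) ℂ, ∀ y : Matrix (Fin (n + 1)) (Fin (n + 1)) ℂ, y.trace = 0 →
          evalF n F (gmat n ↑B * y * gmat n ↑(B⁻¹)) = evalF n F y) →
        evalF n F x = 0) ↔
      (IsNilpotent x ∧ IsNilpotent (prMat n x)) :=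
  ⟨dir1 n x, fun h F h0 hF => dir2 n x hx h.1 h.2 F h0 hF⟩
end
end

section
/- For x ∈ M_{n+1}(ℂ) with tr x = 0, written in blocks x = [[X,a],[b,d]] with X ∈ M_n(ℂ), the following are equivalent: (i) tr(xⁱ) = 0 for all 2 ≤ i ≤ n+1 and tr(Xʲ) = 0 for all 1 ≤ j ≤ n; (ii) x is nilpotent and the matrix [[X,0],[0,d]] is nilpotent. -/
open Matrix

noncomputable section

/-- The upper-left `n × n` block `X` of `x ∈ M_{n+1}(ℂ)`. -/
def ulBlock (n : ℕ) (x : Matrix (Fin (n + 1)) (Fin (n + 1)) ℂ) :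
    Matrix (Fin n) (Fin n) ℂ :=
  x.submatrix Fin.castSucc Fin.castSucc

lemma tr_all {m : ℕ} (A : Matrix (Fin m) (Fin m) ℂ)
    (h : ∀ i, 1 ≤ i → i ≤ m → (A ^ i).trace = 0) : ∀ k, 1 ≤ k → (A ^ k).trace = 0 := by
  intro k
  induction k using Nat.strong_induction_on with
  | _ k ih =>
    intro hk
    by_cases hkm : k ≤ m
    · exact h k hk hkm
    have hdeg : A.charpoly.natDegree = m := by simp
    have hch := Matrix.aeval_self_charpoly A
    rw [Polynomial.aeval_eq_sum_range, hdeg, Finset.sum_range_succ] at hch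
    have hl : A.charpoly.coeff m = 1 := by
      have := A.charpoly_monic.coeff_natDegree
      rwa [hdeg] at this
    rw [hl, one_smul] at hch
    have h2 := congrArg (fun B => (A ^ (k - m) * B).trace) hch
    simp only [mul_add, Finset.mul_sum, mul_smul_comm, ← pow_add, Matrix.trace_add,
      Matrix.trace_sum, Matrix.trace_smul, mul_zero, Matrix.trace_zero] at h2
    rw [Finset.sum_eq_zero, zero_add, Nat.sub_add_cancel (by omega)] at h2
    · exact h2
    · intro i hi
      have hi := Finset.mem_range.1 hi
      rw [ih _ (by omega) (by omega), smul_zero]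

lemma idem_zero {m : ℕ} (f : Matrix (Fin m) (Fin m) ℂ) (hf : f * f = f) (ht : f.trace = 0) :
    f = 0 := by
  have hi : IsIdempotentElem (Matrix.toLin' f) := by
    change _ * _ = _
    rw [Module.End.mul_eq_comp, ← Matrix.toLin'_mul, hf]
  have hp := LinearMap.IsIdempotentElem.isProj_range _ hi
  have := hp.trace
  rw [Matrix.trace_toLin'_eq, ht] at this
  have h0 : Module.finrank ℂ (LinearMap.range (Matrix.toLin' f)) = 0 := by
    exact_mod_cast this.symm
  rw [Submodule.finrank_eq_zero, LinearMap.range_eq_bot] at h0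
  simpa using h0

open Polynomial in
lemma nilp_of_tr {m : ℕ} (A : Matrix (Fin m) (Fin m) ℂ)
    (h : ∀ i, 1 ≤ i → i ≤ m → (A ^ i).trace = 0) : IsNilpotent A := by
  have hall := tr_all A h
  obtain ⟨q, hq, hnd⟩ := Polynomial.exists_eq_pow_rootMultiplicity_mul_and_not_dvd
    A.charpoly A.charpoly_monic.ne_zero 0
  set r := Polynomial.rootMultiplicity 0 A.charpoly
  rw [C_0, sub_zero] at hq hnd
  have hc : IsCoprime ((X : ℂ[X]) ^ (r + 1)) q :=
    IsCoprime.pow_left ((Polynomial.irreducible_X.coprime_iff_not_dvd).2 hnd)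
  obtain ⟨u, v, huv⟩ := hc
  have hz : A ^ r * aeval A q = 0 := by
    have := Matrix.aeval_self_charpoly A
    rw [hq] at this
    simpa using this
  have hz' : aeval A (X ^ (r + 1) * q) = 0 := by
    rw [map_mul, map_pow, aeval_X, pow_succ', mul_assoc, hz, mul_zero]
  have hid : aeval A (u * X ^ (r + 1)) * aeval A (u * X ^ (r + 1))
      = aeval A (u * X ^ (r + 1)) := by
    have e : u * X ^ (r + 1) = (u * X ^ (r + 1)) * (u * X ^ (r + 1))
        + (X ^ (r + 1) * q) * (u * v) := by
      linear_combination (-(u * X ^ (r + 1))) * huv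
    conv_rhs => rw [e, map_add, map_mul _ (X ^ (r + 1) * q), hz', zero_mul, add_zero, map_mul]
  have htr : (aeval A (u * X ^ (r + 1))).trace = 0 := by
    rw [map_mul, map_pow, aeval_X, Polynomial.aeval_eq_sum_range, Finset.sum_mul,
      Matrix.trace_sum]
    refine Finset.sum_eq_zero fun i _ => ?_
    rw [smul_mul_assoc, ← pow_add, Matrix.trace_smul, hall _ (by omega), smul_zero]
  have hf := idem_zero _ hid htr
  refine ⟨r + 1, ?_⟩
  have e : (X : ℂ[X]) ^ (r + 1) = X ^ (r + 1) * (u * X ^ (r + 1)) + (X ^ (r + 1) * q) * v := by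
    linear_combination (-(X ^ (r + 1))) * huv
  have := congrArg (aeval A) e
  rw [map_add, map_mul, map_mul _ (X ^ (r + 1) * q), hf, hz', mul_zero, zero_mul, add_zero,
    map_pow, aeval_X] at this
  exact this

lemma tr_of_nilp {m : ℕ} {A : Matrix (Fin m) (Fin m) ℂ} (h : IsNilpotent A) (i : ℕ)
    (hi : 1 ≤ i) : (A ^ i).trace = 0 :=
  (Matrix.isNilpotent_trace_of_isNilpotent (h.pow_of_pos (by omega))).eq_zero

lemma prMat_pow_s11 (n : ℕ) (x : Matrix (Fin (n + 1)) (Fin (n + 1)) ℂ) (k : ℕ) :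
    prMat n x ^ k = Matrix.reindexAlgEquiv ℂ ℂ finSumFinEquiv
      (Matrix.fromBlocks (ulBlock n x ^ k) 0 0
        ((Matrix.of fun _ _ : Fin 1 => x (Fin.last n) (Fin.last n)) ^ k)) := by
  have h1 : prMat n x = Matrix.reindexAlgEquiv ℂ ℂ finSumFinEquiv
      (Matrix.fromBlocks (ulBlock n x) 0 0
        (Matrix.of fun _ _ : Fin 1 => x (Fin.last n) (Fin.last n))) := by
    rw [← AlgEquiv.symm_apply_eq]
    ext i j
    rcases i with i | i <;> rcases j with j | j
    · have hi : Fin.castAdd 1 i ≠ Fin.last n := (Fin.castSucc_lt_last i).ne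
      have hj : Fin.castAdd 1 j ≠ Fin.last n := (Fin.castSucc_lt_last j).ne
      simp [prMat, ulBlock, hi, hj]
      rfl
    · have hi : Fin.castAdd 1 i ≠ Fin.last n := (Fin.castSucc_lt_last i).ne
      have hj : Fin.natAdd n j = Fin.last n := by ext; simp
      simp [prMat, hi, hj]
    · have hi : Fin.natAdd n i = Fin.last n := by ext; simp
      have hj : Fin.castAdd 1 j ≠ Fin.last n := (Fin.castSucc_lt_last j).ne
      simp [prMat, hi, hj]
    · have hi : Fin.natAdd n i = Fin.last n := by ext; simp
      have hj : Fin.natAdd n j = Fin.last n := by ext; simp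
      simp [prMat, hi, hj]
  rw [h1, ← map_pow, Matrix.fromBlocks_diagonal_pow]

/-- For a traceless `(n+1) × (n+1)` matrix `x = [[X, a], [b, d]]`:
`tr (xⁱ) = 0` for `2 ≤ i ≤ n+1` and `tr (Xʲ) = 0` for `1 ≤ j ≤ n` iff `x` is nilpotent and
`[[X, 0], [0, d]]` is nilpotent. -/
theorem statement11 (n : ℕ) (hn : 1 ≤ n)
    (x : Matrix (Fin (n + 1)) (Fin (n + 1)) ℂ) (hx : x.trace = 0) :
    ((∀ i : ℕ, 2 ≤ i → i ≤ n + 1 → (x ^ i).trace = 0) ∧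
        (∀ j : ℕ, 1 ≤ j → j ≤ n → (ulBlock n x ^ j).trace = 0)) ↔
      (IsNilpotent x ∧ IsNilpotent (prMat n x)) := by
  constructor
  · rintro ⟨h1, h2⟩
    refine ⟨nilp_of_tr x fun i hi hin => ?_, ?_⟩
    · rcases Nat.lt_or_ge 1 i with h | h
      · exact h1 i h hin
      · obtain rfl : i = 1 := by omega
        simpa using hx
    · obtain ⟨N, hN⟩ := nilp_of_tr _ h2
      have hd : x (Fin.last n) (Fin.last n) = 0 := by
        have h3 := h2 1 le_rfl hn
        rw [pow_one] at h3
        rw [Matrix.trace, Fin.sum_univ_castSucc] at hx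
        have h4 : ∑ i : Fin n, x.diag i.castSucc = 0 := h3
        rw [h4, zero_add] at hx
        exact hx
      refine ⟨N + 1, ?_⟩
      rw [prMat_pow_s11, pow_succ, hN, hd]
      have : (Matrix.of fun _ _ : Fin 1 => (0 : ℂ)) = 0 := rfl
      rw [this]
      simp
  · rintro ⟨h1, N, hN⟩
    refine ⟨fun i hi _ => tr_of_nilp h1 i (by omega), fun j hj _ => tr_of_nilp ⟨N, ?_⟩ j hj⟩
    rw [prMat_pow_s11, EmbeddingLike.map_eq_zero_iff] at hN
    have := congrArg Matrix.toBlocks₁₁ hN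
    rw [Matrix.toBlocks_fromBlocks₁₁] at this
    exact this
end
end

section
/- Every K̃^ℂ-invariant polynomial function on sl(n+1,ℂ) is a polynomial in the 2n functions f₁,…,fₙ,φ₁,…,φₙ: if f is a polynomial function on sl(n+1,ℂ) with f(gxg⁻¹) = f(x) for all g ∈ K̃^ℂ and all x ∈ sl(n+1,ℂ), then there exists a polynomial Q ∈ ℂ[Y₁,…,Yₙ,Z₁,…,Zₙ] such that f(x) = Q(tr x², …, tr x^{n+1}, tr X, …, tr Xⁿ) for all x ∈ sl(n+1,ℂ), where X denotes the upper-left n×n block of x. -/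
open Matrix

noncomputable section

theorem det_aeval_roots {m : ℕ} (M : Matrix (Fin m) (Fin m) ℂ) (q : Polynomial ℂ) :
    (Polynomial.aeval M q).det = (M.charpoly.roots.map (fun l => q.eval l)).prod := by
  have hsp := IsAlgClosed.splits M.charpoly
  have hcard : M.charpoly.roots.card = m := by
    rw [← hsp.natDegree_eq_card_roots, Matrix.charpoly_natDegree_eq_dim]; simp
  have hmul : ∀ p q : Polynomial ℂ,
      (Polynomial.aeval M p).det = (M.charpoly.roots.map (fun l => p.eval l)).prod →
      (Polynomial.aeval M q).det = (M.charpoly.roots.map (fun l => q.eval l)).prod →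
      (Polynomial.aeval M (p * q)).det
        = (M.charpoly.roots.map (fun l => (p * q).eval l)).prod := by
    intro p q hp hq
    simp only [map_mul, Matrix.det_mul, hp, hq, Polynomial.eval_mul, Multiset.prod_map_mul]
  have hC : ∀ a : ℂ, (Polynomial.aeval M (Polynomial.C a)).det
        = (M.charpoly.roots.map (fun l => (Polynomial.C a).eval l)).prod := by
    intro a
    simp [hcard, Matrix.algebraMap_eq_diagonal]
  have hX : ∀ a : ℂ, (Polynomial.aeval M (Polynomial.X - Polynomial.C a)).det
        = (M.charpoly.roots.map (fun l => (Polynomial.X - Polynomial.C a).eval l)).prod := by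
    intro a
    have h1 := Matrix.eval_charpoly M a
    have h2 : M.charpoly.eval a = (M.charpoly.roots.map (fun l => a - l)).prod := by
      conv_lhs => rw [hsp.eq_prod_roots, M.charpoly_monic.leadingCoeff]
      simp [Polynomial.eval_multiset_prod]
    have h3 : Polynomial.aeval M (Polynomial.X - Polynomial.C a) = -(Matrix.scalar (Fin m) a - M) := by
      simp [Matrix.algebraMap_eq_diagonal]
    rw [h3, Matrix.det_neg, ← h1, h2]
    simp only [Polynomial.eval_sub, Polynomial.eval_X, Polynomial.eval_C]
    have : (fun l : ℂ => l - a) = fun l => (-1) * (a - l) := by funext l; ring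
    rw [this, Multiset.prod_map_mul]
    simp [hcard]
  rw [(IsAlgClosed.splits q).eq_prod_roots]
  apply hmul _ _ (hC _)
  induction q.roots using Multiset.induction_on with
  | empty => simp
  | cons a s ih =>
    rw [Multiset.map_cons, Multiset.prod_cons]
    exact hmul _ _ (hX a) ih

theorem trace_pow_roots {m : ℕ} (M : Matrix (Fin m) (Fin m) ℂ) (k : ℕ) :
    (M ^ k).trace = (M.charpoly.roots.map (fun l => l ^ k)).sum := by
  have h : (M ^ k).charpoly
      = ((M.charpoly.roots.map (fun l => l ^ k)).map (fun a => Polynomial.X - Polynomial.C a)).prod := by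
    apply Polynomial.funext
    intro a
    rw [Matrix.eval_charpoly]
    have := det_aeval_roots M (Polynomial.C a - Polynomial.X ^ k)
    simp only [map_sub, map_pow, Polynomial.aeval_X, Polynomial.aeval_C, Polynomial.eval_sub,
      Polynomial.eval_C, Polynomial.eval_pow, Polynomial.eval_X] at this
    rw [Polynomial.eval_multiset_prod]
    simp only [Multiset.map_map, Function.comp_def, Polynomial.eval_sub, Polynomial.eval_C,
      Polynomial.eval_X]
    rw [← this, Matrix.algebraMap_eq_diagonal]
    rfl
  rw [Matrix.trace_eq_sum_roots_charpoly, h, Polynomial.roots_multiset_prod_X_sub_C]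

theorem newton_roots (s : Multiset ℂ) (k : ℕ) :
    (k : ℂ) * s.esymm k = (-1) ^ (k + 1) *
      ∑ a ∈ Finset.HasAntidiagonal.antidiagonal k with a.1 < k,
        (-1) ^ a.1 * s.esymm a.1 * (s.map (fun l => l ^ a.2)).sum := by
  obtain ⟨l, rfl⟩ := Quot.exists_rep s
  have hs : (Quot.mk _ l : Multiset ℂ) = Multiset.map l.get (Finset.univ : Finset (Fin l.length)).val := by
    simp [Fin.univ_val_map]; rfl
  rw [hs]
  have := congrArg (MvPolynomial.aeval l.get) (MvPolynomial.mul_esymm_eq_sum (Fin l.length) ℂ k)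
  simp only [map_mul, map_sum, map_pow, map_neg, map_one, map_natCast,
    MvPolynomial.aeval_esymm_eq_multiset_esymm, MvPolynomial.psum, MvPolynomial.aeval_X] at this
  rw [this]
  simp only [Multiset.map_map, Function.comp_def]
  rfl

theorem charpoly_coeff_mem {S : Type*} {m : ℕ} (M : S → Matrix (Fin m) (Fin m) ℂ)
    (A : Subalgebra ℂ (S → ℂ))
    (h : ∀ k, 1 ≤ k → k ≤ m → (fun s => (M s ^ k).trace) ∈ A) (k : ℕ) :
    (fun s => (M s).charpoly.coeff k) ∈ A := by
  have hE : ∀ k, k ≤ m → (fun s => (M s).charpoly.roots.esymm k) ∈ A := by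
    intro k
    induction k using Nat.strong_induction_on with
    | _ k ih =>
    intro hk
    rcases Nat.eq_zero_or_pos k with rfl | hpos
    · have e : (fun s => (M s).charpoly.roots.esymm 0) = 1 := by
        funext s; simp [Multiset.esymm]
      rw [e]; exact A.one_mem
    have e : (fun s => (M s).charpoly.roots.esymm k) = ((k : ℂ)⁻¹ * (-1) ^ (k + 1)) •
      ∑ a ∈ Finset.HasAntidiagonal.antidiagonal k with a.1 < k,
        ((-1 : ℂ) ^ a.1) • ((fun s => (M s).charpoly.roots.esymm a.1) * (fun s => (M s ^ a.2).trace)) := by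
      funext s
      have hk0 : (k : ℂ) ≠ 0 := by exact_mod_cast hpos.ne'
      have := newton_roots (M s).charpoly.roots k
      simp only [← trace_pow_roots] at this
      simp only [Pi.smul_apply, Finset.sum_apply, Pi.mul_apply, smul_eq_mul]
      rw [mul_assoc, eq_inv_mul_iff_mul_eq₀ hk0, this]
      simp only [mul_assoc]
    rw [e]
    apply A.smul_mem
    apply A.sum_mem
    intro a ha
    simp only [Finset.mem_filter, Finset.HasAntidiagonal.mem_antidiagonal] at ha
    apply A.smul_mem
    exact A.mul_mem (ih _ ha.2 (by omega)) (h _ (by omega) (by omega))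
  by_cases hk : k ≤ m
  · have e : (fun s => (M s).charpoly.coeff k) = ((-1 : ℂ) ^ (m - k)) • (fun s => (M s).charpoly.roots.esymm (m - k)) := by
      funext s
      rw [Polynomial.coeff_eq_esymm_roots_of_splits (IsAlgClosed.splits _)]
      · simp [(M s).charpoly_monic.leadingCoeff]
      · simpa using hk
    rw [e]
    exact A.smul_mem (hE _ (by omega)) _
  · have e : (fun s => (M s).charpoly.coeff k) = 0 := by
      funext s
      apply Polynomial.coeff_eq_zero_of_natDegree_lt
      rw [Matrix.charpoly_natDegree_eq_dim]; simpa using hk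
    rw [e]; exact A.zero_mem

theorem charpolyRev_coeff_mem {S : Type*} {m : ℕ} (M : S → Matrix (Fin m) (Fin m) ℂ)
    (A : Subalgebra ℂ (S → ℂ))
    (h : ∀ k, 1 ≤ k → k ≤ m → (fun s => (M s ^ k).trace) ∈ A) (k : ℕ) :
    (fun s => (M s).charpolyRev.coeff k) ∈ A := by
  have := charpoly_coeff_mem M A h (Polynomial.revAt m k)
  convert this using 2 with s
  rw [← Matrix.reverse_charpoly, Polynomial.coeff_reverse, Matrix.charpoly_natDegree_eq_dim]
  simp

/-! power series part -/

theorem ps_inverse {n : ℕ} (X : Matrix (Fin n) (Fin n) ℂ) :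
    (1 - (PowerSeries.X : PowerSeries ℂ) • X.map (PowerSeries.C (R := ℂ))) *
      (Matrix.of fun i j => PowerSeries.mk fun k => (X ^ k) i j) = 1 := by
  rw [Matrix.sub_mul, Matrix.one_mul, Matrix.smul_mul]
  ext i j k
  rw [Matrix.sub_apply, Matrix.smul_apply, Matrix.mul_apply]
  rcases k with _ | k
  · simp [Matrix.one_apply]
  · simp only [Matrix.of_apply, map_sub, PowerSeries.coeff_mk, smul_eq_mul,
      PowerSeries.coeff_succ_X_mul, map_sum, Matrix.map_apply, PowerSeries.coeff_C_mul, pow_succ',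
      Matrix.mul_apply, sub_self]
    rw [Matrix.one_apply]
    split_ifs <;> simp [PowerSeries.coeff_one]

/-- The block matrix with given blocks. -/
def blk {R : Type*} {n : ℕ} (X : Matrix (Fin n) (Fin n) R) (v w : Fin n → R) (c : R) :
    Matrix (Fin (n + 1)) (Fin (n + 1)) R :=
  Matrix.of fun i j =>
    Fin.lastCases (motive := fun _ => R) (Fin.lastCases (motive := fun _ => R) c w j)
      (fun i => Fin.lastCases (motive := fun _ => R) (v i) (X i) j) i

section blk
variable {R : Type*} {n : ℕ} (X : Matrix (Fin n) (Fin n) R) (v w : Fin n → R) (c : R)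
@[simp] theorem blk_cc (i j : Fin n) : blk X v w c i.castSucc j.castSucc = X i j := by simp [blk]
@[simp] theorem blk_cl (i : Fin n) : blk X v w c i.castSucc (Fin.last n) = v i := by simp [blk]
@[simp] theorem blk_lc (j : Fin n) : blk X v w c (Fin.last n) j.castSucc = w j := by simp [blk]
@[simp] theorem blk_ll : blk X v w c (Fin.last n) (Fin.last n) = c := by simp [blk]

theorem blk_ext {R : Type*} {n : ℕ} {x y : Matrix (Fin (n + 1)) (Fin (n + 1)) R}
    (h1 : ∀ i j : Fin n, x i.castSucc j.castSucc = y i.castSucc j.castSucc)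
    (h2 : ∀ i : Fin n, x i.castSucc (Fin.last n) = y i.castSucc (Fin.last n))
    (h3 : ∀ j : Fin n, x (Fin.last n) j.castSucc = y (Fin.last n) j.castSucc)
    (h4 : x (Fin.last n) (Fin.last n) = y (Fin.last n) (Fin.last n)) : x = y := by
  ext i j
  refine Fin.lastCases ?_ (fun i => ?_) i <;> refine Fin.lastCases ?_ (fun j => ?_) j
  · exact h4
  · exact h3 j
  · exact h2 i
  · exact h1 i j
end blk

theorem det_blk {R : Type*} [CommRing R] {n : ℕ} (X N : Matrix (Fin n) (Fin n) R) (v w : Fin n → R)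
    (c : R) (hN : X * N = 1) : (blk X v w c).det = X.det * (c - w ⬝ᵥ (N *ᵥ v)) := by
  have e : blk X v w c = (Matrix.fromBlocks X (Matrix.of fun i (_ : Fin 1) => v i)
      (Matrix.of fun (_ : Fin 1) j => w j) (Matrix.of fun _ _ => c)).submatrix
        finSumFinEquiv.symm finSumFinEquiv.symm := by
    have hl : finSumFinEquiv.symm (Fin.last n) = Sum.inr (0 : Fin 1) := by
      rw [Equiv.symm_apply_eq]; rfl
    have hc : ∀ i : Fin n, finSumFinEquiv.symm i.castSucc = (Sum.inl i : Fin n ⊕ Fin 1) := by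
      intro i; rw [Equiv.symm_apply_eq]; rfl
    apply blk_ext <;> simp [hl, hc]
  let _ : Invertible X := ⟨N, mul_eq_one_comm.mp hN, hN⟩
  have hinv : ⅟X = N := rfl
  rw [e, Matrix.det_submatrix_equiv_self, Matrix.det_fromBlocks₁₁, hinv, Matrix.det_fin_one]
  congr 1
  rw [Matrix.sub_apply, Matrix.mul_assoc, Matrix.mul_apply]
  simp [dotProduct, Matrix.mulVec, Matrix.mul_apply]

theorem charpolyRev_blk {n : ℕ} (X : Matrix (Fin n) (Fin n) ℂ) (v w : Fin n → ℂ) (c : ℂ) :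
    ((blk X v w c).charpolyRev : PowerSeries ℂ) = (X.charpolyRev : PowerSeries ℂ) *
      (1 - PowerSeries.X * PowerSeries.C c -
        PowerSeries.X ^ 2 * PowerSeries.mk fun k => w ⬝ᵥ (X ^ k *ᵥ v)) := by
  have key : ∀ {m : ℕ} (M : Matrix (Fin m) (Fin m) ℂ), (M.charpolyRev : PowerSeries ℂ)
      = (1 - (PowerSeries.X : PowerSeries ℂ) • M.map (PowerSeries.C (R := ℂ))).det := by
    intro m M
    have := RingHom.map_det (Polynomial.coeToPowerSeries.ringHom (R := ℂ))
      (1 - (Polynomial.X : Polynomial ℂ) • M.map Polynomial.C)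
    rw [Matrix.charpolyRev]
    refine Eq.trans this ?_
    congr 1
    ext1 i j
    simp [Matrix.one_apply]
    split_ifs <;> simp [mul_comm]
  rw [key, key]
  have e : (1 - (PowerSeries.X : PowerSeries ℂ) • (blk X v w c).map (PowerSeries.C (R := ℂ)))
      = blk (1 - (PowerSeries.X : PowerSeries ℂ) • X.map (PowerSeries.C (R := ℂ)))
        (fun i => - (PowerSeries.X * PowerSeries.C (v i)))
        (fun i => - (PowerSeries.X * PowerSeries.C (w i))) (1 - PowerSeries.X * PowerSeries.C c) := by
    apply blk_ext
    · intro i j; simp [Matrix.one_apply]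
    · intro i; simp [(Fin.castSucc_lt_last i).ne]
    · intro i; simp [(Fin.castSucc_lt_last i).ne']
    · simp
  rw [e, det_blk _ _ _ _ _ (ps_inverse X)]
  congr 2
  have : (PowerSeries.mk fun k => w ⬝ᵥ (X ^ k *ᵥ v)) = ∑ i, PowerSeries.C (w i) *
      ∑ j, PowerSeries.mk (fun k => (X ^ k) i j) * PowerSeries.C (v j) := by
    ext k
    simp [dotProduct, Matrix.mulVec]
  rw [this]
  simp only [dotProduct, Matrix.mulVec, Matrix.of_apply, Finset.mul_sum]
  refine Finset.sum_congr rfl fun i _ => Finset.sum_congr rfl fun j _ => ?_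
  ring

theorem moment_mem {S : Type*} {n : ℕ} (X : S → Matrix (Fin n) (Fin n) ℂ) (v w : S → Fin n → ℂ)
    (c : S → ℂ) (A : Subalgebra ℂ (S → ℂ))
    (h1 : ∀ k, (fun s => (X s).charpolyRev.coeff k) ∈ A)
    (h2 : ∀ k, (fun s => (blk (X s) (v s) (w s) (c s)).charpolyRev.coeff k) ∈ A) (k : ℕ) :
    (fun s => w s ⬝ᵥ (X s ^ k *ᵥ v s)) ∈ A := by
  set g : S → PowerSeries ℂ := fun s => (1 - PowerSeries.X * PowerSeries.C (c s) -
        PowerSeries.X ^ 2 * PowerSeries.mk fun k => w s ⬝ᵥ (X s ^ k *ᵥ v s)) with hg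
  have hrec : ∀ s k, (blk (X s) (v s) (w s) (c s)).charpolyRev.coeff k =
      ∑ a ∈ Finset.HasAntidiagonal.antidiagonal k,
        (X s).charpolyRev.coeff a.1 * PowerSeries.coeff a.2 (g s) := by
    intro s k
    have := congrArg (PowerSeries.coeff k) (charpolyRev_blk (X s) (v s) (w s) (c s))
    rw [PowerSeries.coeff_mul] at this
    simpa only [Polynomial.coeff_coe] using this
  have h0 : ∀ s, (X s).charpolyRev.coeff 0 = 1 := by
    intro s
    rw [Polynomial.coeff_zero_eq_eval_zero, Matrix.eval_charpolyRev]
  have hmem : ∀ k, (fun s => PowerSeries.coeff k (g s)) ∈ A := by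
    intro k
    induction k using Nat.strong_induction_on with
    | _ k ih =>
    have e : (fun s => PowerSeries.coeff k (g s)) =
        (fun s => (blk (X s) (v s) (w s) (c s)).charpolyRev.coeff k) -
        ∑ a ∈ (Finset.HasAntidiagonal.antidiagonal k).erase (0, k),
          (fun s => (X s).charpolyRev.coeff a.1) * (fun s => PowerSeries.coeff a.2 (g s)) := by
      funext s
      simp only [Pi.sub_apply, Finset.sum_apply, Pi.mul_apply]
      rw [hrec, ← Finset.add_sum_erase _ _ (a := (0, k)) (by simp)]
      simp [h0]
    rw [e]
    refine A.sub_mem (h2 k) (A.sum_mem fun a ha => A.mul_mem (h1 _) (ih _ ?_))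
    obtain ⟨a, b⟩ := a
    simp only [Finset.mem_erase, Finset.HasAntidiagonal.mem_antidiagonal, ne_eq, Prod.mk.injEq] at ha
    omega
  have := A.neg_mem (hmem (k + 2))
  convert this using 1
  funext s
  simp only [hg, Pi.neg_apply, map_sub]
  rw [show k + 2 = (k + 1) + 1 from rfl, PowerSeries.coeff_succ_X_mul, pow_two, mul_assoc,
    PowerSeries.coeff_succ_X_mul, PowerSeries.coeff_succ_X_mul, PowerSeries.coeff_mk]
  simp [PowerSeries.coeff_one]

/-! conjugation part -/

theorem gmat_eq_blk (n : ℕ) (B : Matrix (Fin n) (Fin n) ℂ) : gmat n B = blk B 0 0 (B.det)⁻¹ := by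
  apply blk_ext <;> simp [gmat]

theorem blk_mul {R : Type*} [CommRing R] {n : ℕ} (X X' : Matrix (Fin n) (Fin n) R)
    (v w v' w' : Fin n → R) (c c' : R) :
    blk X v w c * blk X' v' w' c' =
      blk (X * X' + Matrix.vecMulVec v w') (X *ᵥ v' + c' • v) (w ᵥ* X' + c • w')
        (w ⬝ᵥ v' + c * c') := by
  apply blk_ext <;> intros <;>
    simp [Matrix.mul_apply, Fin.sum_univ_castSucc, Matrix.vecMulVec, Matrix.mulVec, Matrix.vecMul,
      dotProduct, mul_comm]

theorem conj_blk {n : ℕ} (B : GL (Fin n) ℂ) (X : Matrix (Fin n) (Fin n) ℂ)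
    (v w : Fin n → ℂ) (c : ℂ) :
    gmat n ↑B * blk X v w c * gmat n ↑(B⁻¹) =
      blk ((B : Matrix (Fin n) (Fin n) ℂ) * X * (↑(B⁻¹) : Matrix (Fin n) (Fin n) ℂ))
        ((B : Matrix (Fin n) (Fin n) ℂ).det • ((B : Matrix (Fin n) (Fin n) ℂ) *ᵥ v))
        ((B : Matrix (Fin n) (Fin n) ℂ).det⁻¹ • (w ᵥ* (↑(B⁻¹) : Matrix (Fin n) (Fin n) ℂ))) c := by
  have hd : (B : Matrix (Fin n) (Fin n) ℂ).det ≠ 0 := B.isUnit.map Matrix.detMonoidHom |>.ne_zero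
  have hd' : (↑(B⁻¹) : Matrix (Fin n) (Fin n) ℂ).det = (B : Matrix (Fin n) (Fin n) ℂ).det⁻¹ := by
    apply eq_inv_of_mul_eq_one_left
    rw [← Matrix.det_mul, ← Units.val_mul]; simp
  rw [gmat_eq_blk, gmat_eq_blk, blk_mul, blk_mul, hd', inv_inv]
  congr 1
  · simp
  · simp
  · simp [Matrix.smul_vecMul]
  · simp; field_simp

theorem exists_scale {n : ℕ} (C : GL (Fin n) ℂ) : ∃ (B : GL (Fin n) ℂ) (t : ℂ), t ≠ 0 ∧
    (B : Matrix (Fin n) (Fin n) ℂ).det = t ∧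
    (B : Matrix (Fin n) (Fin n) ℂ) = t⁻¹ • (C : Matrix (Fin n) (Fin n) ℂ) ∧
    (↑(B⁻¹) : Matrix (Fin n) (Fin n) ℂ) = t • (↑(C⁻¹) : Matrix (Fin n) (Fin n) ℂ) := by
  have hd : (C : Matrix (Fin n) (Fin n) ℂ).det ≠ 0 := C.isUnit.map Matrix.detMonoidHom |>.ne_zero
  obtain ⟨t, ht⟩ := IsAlgClosed.exists_pow_nat_eq (C : Matrix (Fin n) (Fin n) ℂ).det
    (n := n + 1) (by omega)
  have ht0 : t ≠ 0 := by
    rintro rfl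
    apply hd; rw [← ht]; simp
  refine ⟨⟨t⁻¹ • (C : Matrix (Fin n) (Fin n) ℂ), t • (↑(C⁻¹) : Matrix (Fin n) (Fin n) ℂ), ?_, ?_⟩,
    t, ht0, ?_, rfl, rfl⟩
  · rw [Matrix.smul_mul, Matrix.mul_smul, smul_smul, inv_mul_cancel₀ ht0, ← Units.val_mul]; simp
  · rw [Matrix.smul_mul, Matrix.mul_smul, smul_smul, mul_inv_cancel₀ ht0, ← Units.val_mul]; simp
  · simp only [Matrix.det_smul, Fintype.card_fin, ← ht]
    rw [pow_succ, ← mul_assoc, ← mul_pow, inv_mul_cancel₀ ht0]; simp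

theorem inv_GL (n : ℕ) (F : MvPolynomial (Fin (n + 1) × Fin (n + 1)) ℂ)
    (hinv : ∀ B : GL (Fin n) ℂ, ∀ x : Matrix (Fin (n + 1)) (Fin (n + 1)) ℂ, x.trace = 0 →
      evalF n F (gmat n ↑B * x * gmat n ↑(B⁻¹)) = evalF n F x)
    (C : GL (Fin n) ℂ) (X : Matrix (Fin n) (Fin n) ℂ) (v w : Fin n → ℂ) (c : ℂ)
    (h : (blk X v w c).trace = 0) :
    evalF n F (blk X v w c) =
    evalF n F (blk ((C : Matrix (Fin n) (Fin n) ℂ) * X * (↑(C⁻¹) : Matrix (Fin n) (Fin n) ℂ))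
        ((C : Matrix (Fin n) (Fin n) ℂ) *ᵥ v)
        (w ᵥ* (↑(C⁻¹) : Matrix (Fin n) (Fin n) ℂ)) c) := by
  obtain ⟨B, t, ht, h1, h2, h3⟩ := exists_scale C
  rw [← hinv B _ h, conj_blk, h1, h2, h3]
  congr 2
  · simp [smul_smul, ht]
  · simp [Matrix.smul_mulVec, smul_smul, ht]
  · simp [Matrix.vecMul_smul, smul_smul, ht]

/-- Krylov matrix. -/
def kry {R : Type*} [CommRing R] {n : ℕ} (X : Matrix (Fin n) (Fin n) R) (v : Fin n → R) :
    Matrix (Fin n) (Fin n) R :=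
  Matrix.of fun i k => (X ^ (k : ℕ) *ᵥ v) i

/-- Companion matrix. -/
def cmpM {n : ℕ} (X : Matrix (Fin n) (Fin n) ℂ) : Matrix (Fin n) (Fin n) ℂ :=
  Matrix.of fun i j =>
    if (j : ℕ) + 1 < n then (if (i : ℕ) = j + 1 then 1 else 0) else - X.charpoly.coeff i

theorem mul_kry {n : ℕ} (X : Matrix (Fin n) (Fin n) ℂ) (v : Fin n → ℂ) :
    X * kry X v = kry X v * cmpM X := by
  ext i j
  have hl : (X * kry X v) i j = (X ^ ((j : ℕ) + 1) *ᵥ v) i := by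
    rw [pow_succ', ← Matrix.mulVec_mulVec]; rfl
  rw [hl, Matrix.mul_apply]
  by_cases hj : (j : ℕ) + 1 < n
  · rw [Finset.sum_eq_single ⟨(j : ℕ) + 1, hj⟩]
    · simp [kry, cmpM, hj]
    · intro b _ hb
      have : (b : ℕ) ≠ j + 1 := fun h => hb (Fin.ext h)
      simp [cmpM, hj, this]
    · simp
  · have hn : (j : ℕ) + 1 = n := by omega
    have hch := Matrix.aeval_self_charpoly X
    rw [Polynomial.aeval_eq_sum_range, Matrix.charpoly_natDegree_eq_dim, Fintype.card_fin,
      Finset.sum_range_succ] at hch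
    have hlead : X.charpoly.coeff n = 1 := by
      have := X.charpoly_monic.coeff_natDegree
      rwa [Matrix.charpoly_natDegree_eq_dim, Fintype.card_fin] at this
    rw [hlead, one_smul, Finset.sum_range] at hch
    have h2 : X ^ n = - ∑ k : Fin n, X.charpoly.coeff k • X ^ (k : ℕ) :=
      eq_neg_of_add_eq_zero_right hch
    rw [hn, h2, Matrix.neg_mulVec, Matrix.sum_mulVec]
    simp [kry, cmpM, hj, Finset.sum_apply, Matrix.smul_mulVec, mul_comm]

/-- Slice representative. -/
def slice {n : ℕ} (X : Matrix (Fin n) (Fin n) ℂ) (v w : Fin n → ℂ) (c : ℂ) :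
    Matrix (Fin (n + 1)) (Fin (n + 1)) ℂ :=
  blk (cmpM X) (fun i => if (i : ℕ) = 0 then 1 else 0) (fun k => w ⬝ᵥ (X ^ (k : ℕ) *ᵥ v)) c

theorem eval_slice (n : ℕ) (hn : 1 ≤ n) (F : MvPolynomial (Fin (n + 1) × Fin (n + 1)) ℂ)
    (hinv : ∀ B : GL (Fin n) ℂ, ∀ x : Matrix (Fin (n + 1)) (Fin (n + 1)) ℂ, x.trace = 0 →
      evalF n F (gmat n ↑B * x * gmat n ↑(B⁻¹)) = evalF n F x)
    (X : Matrix (Fin n) (Fin n) ℂ) (v w : Fin n → ℂ) (c : ℂ)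
    (h : (blk X v w c).trace = 0) (hd : (kry X v).det ≠ 0) :
    evalF n F (blk X v w c) = evalF n F (slice X v w c) := by
  set P := Matrix.GeneralLinearGroup.mkOfDetNeZero (kry X v) hd with hP
  have hPv : (P : Matrix (Fin n) (Fin n) ℂ) = kry X v := rfl
  have hPP : (↑(P⁻¹) : Matrix (Fin n) (Fin n) ℂ) * kry X v = 1 := by
    rw [← hPv, ← Units.val_mul]; simp
  rw [inv_GL n F hinv P⁻¹ X v w c h, inv_inv, slice]
  congr 2
  · rw [hPv, Matrix.mul_assoc, mul_kry, ← Matrix.mul_assoc, hPP, Matrix.one_mul]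
  · have : kry X v *ᵥ (fun i => if (i : ℕ) = 0 then 1 else 0) = v := by
      funext i
      rw [Matrix.mulVec, dotProduct, Finset.sum_eq_single ⟨0, hn⟩]
      · simp [kry]
      · intro b _ hb
        have : (b : ℕ) ≠ 0 := fun h => hb (Fin.ext h)
        simp [this]
      · simp
    conv_lhs => rw [← this]
    rw [Matrix.mulVec_mulVec, hPP, Matrix.one_mulVec]

theorem trace_blk {n : ℕ} (X : Matrix (Fin n) (Fin n) ℂ) (v w : Fin n → ℂ) (c : ℂ) :
    (blk X v w c).trace = X.trace + c := by
  simp [Matrix.trace, Fin.sum_univ_castSucc]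

theorem eq_blk (n : ℕ) (x : Matrix (Fin (n + 1)) (Fin (n + 1)) ℂ) :
    x = blk (ulBlock n x) (fun i => x i.castSucc (Fin.last n)) (fun i => x (Fin.last n) i.castSucc)
      (x (Fin.last n) (Fin.last n)) := by
  apply blk_ext <;> simp [ulBlock]

theorem kry_map {R T : Type*} [CommRing R] [CommRing T] (f : R →+* T) {n : ℕ}
    (X : Matrix (Fin n) (Fin n) R) (v : Fin n → R) :
    f (kry X v).det = (kry (X.map f) (fun i => f (v i))).det := by
  rw [RingHom.map_det]
  congr 1
  ext i k
  have : X.map f = f.mapMatrix X := rfl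
  rw [this]
  simp only [kry, Matrix.of_apply, RingHom.mapMatrix_apply, Matrix.map_apply, RingHom.map_mulVec]
  rw [← RingHom.mapMatrix_apply, ← RingHom.mapMatrix_apply, map_pow]
  rfl

/-- The line joining two matrices avoids the non-cyclic locus outside a finite set. -/
theorem line_finite {n : ℕ} (X X0 : Matrix (Fin n) (Fin n) ℂ) (v v0 : Fin n → ℂ)
    (h0 : (kry X0 v0).det ≠ 0) :
    {t : ℂ | (kry (X + t • (X0 - X)) (v + t • (v0 - v))).det = 0}.Finite := by
  set p : Polynomial ℂ := (kry (X.map Polynomial.C + (Polynomial.X : Polynomial ℂ) • (X0 - X).map Polynomial.C)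
    (fun i => Polynomial.C (v i) + Polynomial.X * Polynomial.C (v0 i - v i))).det with hp
  have he : ∀ t, p.eval t = (kry (X + t • (X0 - X)) (v + t • (v0 - v))).det := by
    intro t
    rw [← Polynomial.coe_evalRingHom, hp, kry_map]
    congr 2
    · ext i j; simp
    · funext i; simp
  have hne : p ≠ 0 := by
    intro h
    have := he 1
    rw [h] at this
    simp at this
    exact h0 this.symm
  have := p.roots.toFinset.finite_toSet
  refine this.subset fun t ht => ?_
  simp only [Finset.mem_coe, Multiset.mem_toFinset, Polynomial.mem_roots hne, Polynomial.IsRoot]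
  rw [he]; exact ht

theorem exists_good (n : ℕ) : ∃ x0 : Matrix (Fin (n + 1)) (Fin (n + 1)) ℂ, x0.trace = 0 ∧
    (kry (ulBlock n x0) (fun i => x0 i.castSucc (Fin.last n))).det ≠ 0 := by
  refine ⟨blk (Matrix.diagonal fun i : Fin n => ((i : ℕ) : ℂ)) 1 0 (-∑ i : Fin n, ((i : ℕ) : ℂ)), ?_, ?_⟩
  · simp [trace_blk]
  · have : kry (ulBlock n (blk (Matrix.diagonal fun i : Fin n => ((i : ℕ) : ℂ)) 1 0
        (-∑ i : Fin n, ((i : ℕ) : ℂ)))) (fun i => blk (Matrix.diagonal fun i : Fin n => ((i : ℕ) : ℂ)) 1 0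
        (-∑ i : Fin n, ((i : ℕ) : ℂ)) i.castSucc (Fin.last n))
        = Matrix.vandermonde (fun i : Fin n => ((i : ℕ) : ℂ)) := by
      have hu : ulBlock n (blk (Matrix.diagonal fun i : Fin n => ((i : ℕ) : ℂ)) 1 0
        (-∑ i : Fin n, ((i : ℕ) : ℂ))) = Matrix.diagonal fun i : Fin n => ((i : ℕ) : ℂ) := by
        ext i j; simp [ulBlock]
      rw [hu]
      ext i k
      simp [kry, Matrix.vandermonde, Matrix.diagonal_pow, Matrix.mulVec_diagonal, Matrix.mulVec]
    rw [this, Matrix.det_vandermonde_ne_zero_iff]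
    intro i j h
    exact Fin.ext (by simpa using h)

theorem eval_mem {S σ : Type*} (A : Subalgebra ℂ (S → ℂ)) (F : MvPolynomial σ ℂ) (g : S → σ → ℂ)
    (h : ∀ i, (fun s => g s i) ∈ A) : (fun s => MvPolynomial.eval (g s) F) ∈ A := by
  induction F using MvPolynomial.induction_on with
  | C a => simp only [MvPolynomial.eval_C]; exact A.algebraMap_mem a
  | add p q hp hq => simp only [map_add]; exact A.add_mem hp hq
  | mul_X p i hp => simp only [map_mul, MvPolynomial.eval_X]; exact A.mul_mem hp (h i)

/-- Every `K̃^ℂ`-invariant polynomial function on `sl(n+1, ℂ)` is a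
polynomial in `tr x², …, tr x^(n+1), tr X, …, tr Xⁿ`, where `X` is the upper-left `n × n`
block of `x`. -/
theorem statement17 (n : ℕ) (hn : 1 ≤ n)
    (F : MvPolynomial (Fin (n + 1) × Fin (n + 1)) ℂ)
    (hinv : ∀ B : GL (Fin n) ℂ, ∀ x : Matrix (Fin (n + 1)) (Fin (n + 1)) ℂ, x.trace = 0 →
      evalF n F (gmat n ↑B * x * gmat n ↑(B⁻¹)) = evalF n F x) :
    ∃ Q : MvPolynomial (Fin n ⊕ Fin n) ℂ,
      ∀ x : Matrix (Fin (n + 1)) (Fin (n + 1)) ℂ, x.trace = 0 →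
        evalF n F x =
          MvPolynomial.eval
            (Sum.elim (fun i : Fin n => (x ^ ((i : ℕ) + 2)).trace)
              (fun j : Fin n => (ulBlock n x ^ ((j : ℕ) + 1)).trace)) Q := by
  set g : {x : Matrix (Fin (n + 1)) (Fin (n + 1)) ℂ // x.trace = 0} → Fin n ⊕ Fin n → ℂ :=
    fun x => Sum.elim (fun i : Fin n => (x.1 ^ ((i : ℕ) + 2)).trace)
              (fun j : Fin n => (ulBlock n x.1 ^ ((j : ℕ) + 1)).trace) with hg
  set A := Algebra.adjoin ℂ (Set.range fun i => fun x => g x i) with hA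
  have hgA : ∀ i, (fun x => g x i) ∈ A := fun i => Algebra.subset_adjoin ⟨i, rfl⟩
  have hX : ∀ k, 1 ≤ k → k ≤ n → (fun x : {x : Matrix (Fin (n + 1)) (Fin (n + 1)) ℂ // x.trace = 0} =>
      (ulBlock n x.1 ^ k).trace) ∈ A := by
    intro k h1 h2
    have := hgA (Sum.inr ⟨k - 1, by omega⟩)
    simpa [hg, Nat.sub_add_cancel h1] using this
  have hx : ∀ k, 1 ≤ k → k ≤ n + 1 →
      (fun x : {x : Matrix (Fin (n + 1)) (Fin (n + 1)) ℂ // x.trace = 0} =>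
      (x.1 ^ k).trace) ∈ A := by
    intro k h1 h2
    rcases Nat.lt_or_ge 1 k with h | h
    · have := hgA (Sum.inl ⟨k - 2, by omega⟩)
      simpa [hg, Nat.sub_add_cancel h] using this
    · obtain rfl : k = 1 := by omega
      have e : (fun x : {x : Matrix (Fin (n + 1)) (Fin (n + 1)) ℂ // x.trace = 0} =>
        (x.1 ^ 1).trace) = 0 := by
        funext x; simpa using x.2
      rw [e]; exact A.zero_mem
  have hc : (fun x : {x : Matrix (Fin (n + 1)) (Fin (n + 1)) ℂ // x.trace = 0} =>
      x.1 (Fin.last n) (Fin.last n)) ∈ A := by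
    have := A.neg_mem (hX 1 le_rfl hn)
    convert this using 1
    funext x
    have h := x.2
    rw [eq_blk n x.1, trace_blk] at h
    simp only [Pi.neg_apply, pow_one]
    linear_combination h
  have hcX := charpoly_coeff_mem _ A hX
  have hm := moment_mem (fun x : {x : Matrix (Fin (n + 1)) (Fin (n + 1)) ℂ // x.trace = 0} =>
    ulBlock n x.1) (fun x i => x.1 i.castSucc (Fin.last n))
    (fun x i => x.1 (Fin.last n) i.castSucc) (fun x => x.1 (Fin.last n) (Fin.last n)) A
    (charpolyRev_coeff_mem _ A hX) (by
      simp only [← eq_blk]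
      exact charpolyRev_coeff_mem _ A hx)
  have h1A : (fun _ => 1 : {x : Matrix (Fin (n + 1)) (Fin (n + 1)) ℂ // x.trace = 0} → ℂ) ∈ A :=
    A.one_mem
  have h0A : (fun _ => 0 : {x : Matrix (Fin (n + 1)) (Fin (n + 1)) ℂ // x.trace = 0} → ℂ) ∈ A :=
    A.zero_mem
  have hFA : (fun x : {x : Matrix (Fin (n + 1)) (Fin (n + 1)) ℂ // x.trace = 0} =>
      evalF n F (slice (ulBlock n x.1) (fun i => x.1 i.castSucc (Fin.last n))
        (fun i => x.1 (Fin.last n) i.castSucc) (x.1 (Fin.last n) (Fin.last n)))) ∈ A := by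
    refine eval_mem A F _ ?_
    rintro ⟨i, j⟩
    refine Fin.lastCases ?_ (fun i => ?_) i <;> refine Fin.lastCases ?_ (fun j => ?_) j <;>
      simp only [slice, blk_cc, blk_cl, blk_lc, blk_ll]
    · exact hc
    · exact hm j
    · split_ifs
      · exact h1A
      · exact h0A
    · simp only [cmpM, Matrix.of_apply]
      split_ifs
      · exact h1A
      · exact h0A
      · exact A.neg_mem (hcX i)
  rw [hA, Algebra.adjoin_range_eq_range_aeval] at hFA
  obtain ⟨Q, hQ⟩ := hFA
  have hQ' : ∀ x, MvPolynomial.eval (g x) Q = evalF n F (slice (ulBlock n x.1)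
      (fun i => x.1 i.castSucc (Fin.last n))
        (fun i => x.1 (Fin.last n) i.castSucc) (x.1 (Fin.last n) (Fin.last n))) := by
    intro x
    have h1 := congrFun hQ x
    rw [← h1]
    have h2 := MvPolynomial.map_aeval (R := ℂ) (fun i => fun x => g x i)
      (Pi.evalRingHom (fun _ => ℂ) x) Q
    refine Eq.trans ?_ h2.symm
    rfl
  refine ⟨Q, fun x hxt => ?_⟩
  obtain ⟨x0, hx0, hd0⟩ := exists_good n
  have hfin := line_finite (ulBlock n x) (ulBlock n x0) (fun i => x i.castSucc (Fin.last n))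
    (fun i => x0 i.castSucc (Fin.last n)) hd0
  have hdense := hfin.countable.dense_compl ℂ
  have htr : ∀ t : ℂ, (x + t • (x0 - x)).trace = 0 := by
    intro t; simp [hxt, hx0]
  have hcont : Continuous fun t : ℂ => x + t • (x0 - x) := by fun_prop
  have hcl : IsClosed {t : ℂ | evalF n F (x + t • (x0 - x)) =
      MvPolynomial.eval (Sum.elim (fun i : Fin n => ((x + t • (x0 - x)) ^ ((i : ℕ) + 2)).trace)
              (fun j : Fin n => (ulBlock n (x + t • (x0 - x)) ^ ((j : ℕ) + 1)).trace)) Q} := by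
    apply isClosed_eq
    · refine (MvPolynomial.continuous_eval F).comp (continuous_pi fun p => ?_)
      exact hcont.matrix_elem _ _
    · refine (MvPolynomial.continuous_eval Q).comp (continuous_pi fun p => ?_)
      rcases p with i | j
      · exact (hcont.pow _).matrix_trace
      · exact ((hcont.matrix_submatrix _ _).pow _).matrix_trace
  have hall : ∀ t : ℂ, t ∈ {t : ℂ | evalF n F (x + t • (x0 - x)) =
      MvPolynomial.eval (Sum.elim (fun i : Fin n => ((x + t • (x0 - x)) ^ ((i : ℕ) + 2)).trace)
              (fun j : Fin n => (ulBlock n (x + t • (x0 - x)) ^ ((j : ℕ) + 1)).trace)) Q} := by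
    intro t
    refine hcl.closure_subset_iff.mpr ?_ (hdense t)
    intro s hs
    have e1 := hQ' ⟨x + s • (x0 - x), htr s⟩
    refine Eq.trans ?_ e1.symm
    have h3 := htr s
    rw [eq_blk n (x + s • (x0 - x))] at h3
    have := eval_slice n hn F hinv _ _ _ _ h3 hs
    rw [← eq_blk] at this
    exact this
  have := hall 0
  simpa using this
end
end

section
/- The 2n polynomial functions on sl(n+1,ℂ) given by x ↦ tr x^{i+1} for 1 ≤ i ≤ n and x ↦ tr Xʲ for 1 ≤ j ≤ n (where X is the upper-left n×n block of x) are algebraically independent over ℂ: if Q ∈ ℂ[Y₁,…,Yₙ,Z₁,…,Zₙ] satisfies Q(tr x², …, tr x^{n+1}, tr X, …, tr Xⁿ) = 0 for all x ∈ sl(n+1,ℂ), then Q = 0. -/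
open Matrix

noncomputable section

open Finset in
lemma exists_esymm_seq (s : ℕ → ℂ) (N : ℕ) : ∃ e : ℕ → ℂ, e 0 = 1 ∧ ∀ k, 0 < k → k ≤ N →
    s k = (-1) ^ (k + 1) * k * e k -
      ∑ a ∈ antidiagonal k with a.1 ∈ Set.Ioo 0 k, (-1) ^ a.1 * e a.1 * s a.2 := by
  induction N with
  | zero => exact ⟨fun _ => 1, rfl, fun k h h' => by omega⟩
  | succ N ih =>
    obtain ⟨e, h0, he⟩ := ih
    let S := ∑ a ∈ antidiagonal (N+1) with a.1 ∈ Set.Ioo 0 (N+1), (-1) ^ a.1 * e a.1 * s a.2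
    refine ⟨Function.update e (N+1) ((-1)^(N+2) * (s (N+1) + S) / ((N+1 : ℕ) : ℂ)), ?_, ?_⟩
    · simp [Function.update_of_ne, h0]
    · intro k hk hkN
      have hsum : ∑ a ∈ antidiagonal k with a.1 ∈ Set.Ioo 0 k, (-1) ^ a.1 *
          (Function.update e (N+1) ((-1)^(N+2) * (s (N+1) + S) / ((N+1 : ℕ) : ℂ))) a.1 * s a.2
          = ∑ a ∈ antidiagonal k with a.1 ∈ Set.Ioo 0 k, (-1) ^ a.1 * e a.1 * s a.2 := by
        refine Finset.sum_congr rfl fun a ha => ?_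
        have := (Finset.mem_filter.1 ha).2.2
        rw [Function.update_of_ne (by omega)]
      rw [hsum]
      rcases Nat.lt_or_ge N k with h | h
      · obtain rfl : k = N + 1 := by omega
        rw [Function.update_self]
        change _ = _ - S
        have hne : ((N+1 : ℕ) : ℂ) ≠ 0 := by exact_mod_cast Nat.succ_ne_zero N
        have h1 : ((-1:ℂ))^(N+1+1) * (-1)^(N+2) = 1 := by
          rw [← pow_add, Even.neg_one_pow ⟨N+2, by ring⟩]
        field_simp
        linear_combination (-(s (N+1) + S)) * h1
      · rw [Function.update_of_ne (by omega)]
        exact he k hk h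

lemma exists_esymm (m : ℕ) (e : ℕ → ℂ) (h0 : e 0 = 1) : ∃ r : Fin m → ℂ, ∀ k ≤ m,
    MvPolynomial.aeval r (MvPolynomial.esymm (Fin m) ℂ k) = e k := by
  let q : Polynomial ℂ := ∑ i ∈ Finset.range m, Polynomial.C ((-1)^(m-i) * e (m-i)) * Polynomial.X ^ i
  have hq : q.degree < m := by
    refine (Polynomial.degree_sum_le _ _).trans_lt ?_
    rw [Finset.sup_lt_iff (by exact WithBot.bot_lt_coe m)]
    intro i hi
    refine (Polynomial.degree_C_mul_X_pow_le _ _).trans_lt ?_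
    exact_mod_cast Finset.mem_range.1 hi
  let p : Polynomial ℂ := Polynomial.X ^ m + q
  have hp : p.Monic := Polynomial.monic_X_pow_add hq
  have hd : p.natDegree = m := by
    have : p.degree = m := by
      simp only [p]
      rw [Polynomial.degree_add_eq_left_of_degree_lt] <;> simp [hq]
    exact Polynomial.natDegree_eq_of_degree_eq_some this
  have hc : p.roots.card = m := by
    rw [← hd]; exact (IsAlgClosed.card_roots_eq_natDegree)
  have hcoef : ∀ k ≤ m, p.coeff (m-k) = (-1)^k * e k := by
    intro k hk
    simp only [p, q, Polynomial.coeff_add, Polynomial.finsetSum_coeff, Polynomial.coeff_C_mul_X_pow,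
      Polynomial.coeff_X_pow]
    rcases Nat.eq_zero_or_pos k with rfl | h
    · simp [h0]
    · rw [if_neg (by omega), Finset.sum_ite_eq, if_pos (by simp; omega)]
      simp [show m - (m - k) = k by omega]
  have hl : p.roots.toList.length = m := by simp [hc]
  refine ⟨fun i => p.roots.toList.get (i.cast hl.symm), fun k hk => ?_⟩
  rw [MvPolynomial.aeval_esymm_eq_multiset_esymm]
  have hmap : (Finset.univ.val.map fun i : Fin m => p.roots.toList.get (i.cast hl.symm)) = p.roots := by
    conv_rhs => rw [← Multiset.coe_toList p.roots]
    have : ∀ (l : List ℂ) (h : l.length = m),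
       (Finset.univ.val.map fun i : Fin m => l.get (i.cast h.symm)) = (l : Multiset ℂ) := by
      intro l h
      subst h
      simp
    exact this _ hl
  rw [hmap]
  have := Polynomial.coeff_eq_esymm_roots_of_card (p := p) (by rw [hc, hd]) (k := m-k) (by omega)
  rw [hcoef k hk, hp.leadingCoeff, hd, show m - (m-k) = k by omega, one_mul] at this
  exact (mul_left_cancel₀ (pow_ne_zero _ (by norm_num)) this).symm

lemma exists_psum (m : ℕ) (s : ℕ → ℂ) : ∃ r : Fin m → ℂ, ∀ k, 0 < k → k ≤ m →
    ∑ i, r i ^ k = s k := by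
  obtain ⟨e, h0, he⟩ := exists_esymm_seq s m
  obtain ⟨r, hr⟩ := exists_esymm m e h0
  refine ⟨r, fun k => ?_⟩
  induction k using Nat.strong_induction_on with
  | _ k ih =>
    intro hk hkm
    have := congrArg (MvPolynomial.aeval r) (MvPolynomial.psum_eq_mul_esymm_sub_sum (Fin m) ℂ k hk)
    have hps : ∀ j, MvPolynomial.aeval r (MvPolynomial.psum (Fin m) ℂ j) = ∑ i, r i ^ j := by
      intro j; simp [MvPolynomial.psum]
    simp only [map_sub, map_mul, map_pow, map_neg, map_one, map_natCast, map_sum, hps] at this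
    rw [this, he k hk hkm, hr k hkm]
    congr 1
    refine Finset.sum_congr rfl fun a ha => ?_
    obtain ⟨h1, h2, h3⟩ := Finset.mem_filter.1 ha
    have h4 := Finset.HasAntidiagonal.mem_antidiagonal.1 h1
    rw [hr _ (by omega), ih a.2 (by omega) (by omega) (by omega)]

lemma lower_pow {m : ℕ} (M : Matrix (Fin m) (Fin m) ℂ) (h : ∀ i j, i < j → M i j = 0) (k : ℕ) :
    (∀ i j, i < j → (M ^ k) i j = 0) ∧ ∀ i, (M ^ k) i i = M i i ^ k := by
  induction k with
  | zero =>
    refine ⟨fun i j hij => ?_, fun i => by simp⟩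
    simp [Matrix.one_apply, hij.ne]
  | succ k ih =>
    obtain ⟨h1, h2⟩ := ih
    refine ⟨fun i j hij => ?_, fun i => ?_⟩
    · rw [pow_succ, Matrix.mul_apply]
      refine Finset.sum_eq_zero fun l _ => ?_
      rcases lt_or_ge i l with hl | hl
      · rw [h1 _ _ hl, zero_mul]
      · rw [h _ _ (hl.trans_lt hij), mul_zero]
    · rw [pow_succ, Matrix.mul_apply, Finset.sum_eq_single i, h2, pow_succ]
      · intro l _ hl
        rcases lt_or_gt_of_ne hl with hl | hl
        · rw [h _ _ hl, mul_zero]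
        · rw [h1 _ _ hl, zero_mul]
      · simp

lemma lower_trace {m : ℕ} (M : Matrix (Fin m) (Fin m) ℂ) (h : ∀ i j, i < j → M i j = 0) (k : ℕ) :
    (M ^ k).trace = ∑ i, M i i ^ k := by
  simp [Matrix.trace, (lower_pow M h k).2]

def krylov {m : ℕ} (T : Matrix (Fin (m+1)) (Fin (m+1)) ℂ) (a : ℕ → ℂ) : ℕ → Fin (m+1) → ℂ
  | 0 => Pi.single 0 1
  | k + 1 => T *ᵥ krylov T a k - a k • krylov T a k

lemma exists_matrix (n : ℕ) (a : Fin n → ℂ) (b : Fin (n+1) → ℂ) :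
    ∃ x : Matrix (Fin (n+1)) (Fin (n+1)) ℂ, (∀ k, (x ^ k).trace = ∑ i, b i ^ k) ∧
      ∀ k, (ulBlock n x ^ k).trace = ∑ i, a i ^ k := by
  let T : Matrix (Fin (n+1)) (Fin (n+1)) ℂ := Matrix.of fun i j =>
    if i = j then b i else if (i : ℕ) = j + 1 then 1 else 0
  have hT : ∀ i j, i < j → T i j = 0 := by
    intro i j hij
    have : (i : ℕ) < j := hij
    simp only [T, Matrix.of_apply]
    rw [if_neg hij.ne, if_neg (by omega)]
  let a' : ℕ → ℂ := fun k => if h : k < n then a ⟨k, h⟩ else 0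
  let u := krylov T a'
  have hu : ∀ k : ℕ, ∀ j : Fin (n+1), (k < j → u k j = 0) ∧ (k = j → u k j = 1) := by
    intro k
    induction k with
    | zero =>
      intro j
      refine ⟨fun h => ?_, fun h => ?_⟩
      · have : j ≠ 0 := by rintro rfl; simp at h
        simp [u, krylov, this]
      · have : j = 0 := Fin.ext h.symm
        simp [u, krylov, this]
    | succ k ih =>
      intro j
      have hs : u (k+1) j = ∑ l, T j l * u k l - a' k * u k j := by
        simp [u, krylov, Matrix.mulVec, dotProduct]
      refine ⟨fun h => ?_, fun h => ?_⟩
      · rw [hs, (ih j).1 (by omega), Finset.sum_eq_zero]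
        · simp
        · intro l _
          rcases Nat.lt_or_ge k l with hl | hl
          · rw [(ih l).1 hl, mul_zero]
          · simp only [T, Matrix.of_apply]
            rw [if_neg (by rintro rfl; omega), if_neg (by omega), zero_mul]
      · rw [hs, (ih j).1 (by omega), Finset.sum_eq_single ⟨k, by omega⟩]
        · rw [(ih _).2 rfl]
          simp only [T, Matrix.of_apply]
          rw [if_neg (by intro hj; have := congrArg Fin.val hj; simp at this; omega), if_pos (by simp [← h])]
          simp
        · intro l _ hl
          rcases Nat.lt_or_ge k l with hl' | hl'
          · rw [(ih l).1 hl', mul_zero]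
          · have : (l : ℕ) ≠ k := fun h => hl (Fin.ext h)
            simp only [T, Matrix.of_apply]
            rw [if_neg (by rintro rfl; omega), if_neg (by omega), zero_mul]
        · simp
  let P : Matrix (Fin (n+1)) (Fin (n+1)) ℂ := Matrix.of fun j k => u k j
  have hdet : P.det = 1 := by
    rw [Matrix.det_of_isUpperTriangular]
    · exact Finset.prod_eq_one fun i _ => (hu i i).2 rfl
    · intro i j hij
      exact (hu j i).1 hij
  have hunit : IsUnit P.det := by rw [hdet]; exact isUnit_one
  have hPP : P⁻¹ * P = 1 := Matrix.nonsing_inv_mul _ hunit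
  have hPP' : P * P⁻¹ = 1 := Matrix.mul_nonsing_inv _ hunit
  refine ⟨P⁻¹ * T * P, fun k => ?_, ?_⟩
  · have : (P⁻¹ * T * P) ^ k = P⁻¹ * T ^ k * P := by
      induction k with
      | zero => simp [hPP]
      | succ k ih =>
        rw [pow_succ, ih, pow_succ]
        calc _ = P⁻¹ * T ^ k * (P * P⁻¹) * T * P := by simp only [Matrix.mul_assoc]
          _ = _ := by rw [hPP']; simp only [Matrix.mul_assoc, Matrix.one_mul, Matrix.mul_one]
    rw [this, Matrix.trace_mul_comm, ← Matrix.mul_assoc, hPP', Matrix.one_mul, lower_trace T hT]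
    simp [T]
  · have key : ∀ j k : Fin n, ulBlock n (P⁻¹ * T * P) j k =
        (if (j : ℕ) = k + 1 then 1 else 0) + a k * (if j = k then 1 else 0) := by
      intro j k
      have hcol : ∀ i, (T * P) i k.castSucc = P i k.succ + a k * P i k.castSucc := by
        intro i
        have : P i k.succ = u (k+1) i := rfl
        rw [this]
        have ha : a' k = a k := by simp [a']
        simp [u, krylov, Matrix.mulVec, dotProduct, Matrix.mul_apply, P, ha]
      have : ulBlock n (P⁻¹ * T * P) j k =
          (P⁻¹ * P) j.castSucc k.succ + a k * (P⁻¹ * P) j.castSucc k.castSucc := by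
        rw [ulBlock, Matrix.submatrix_apply, Matrix.mul_assoc, Matrix.mul_apply]
        simp only [hcol]
        rw [Matrix.mul_apply, Matrix.mul_apply, Finset.mul_sum, ← Finset.sum_add_distrib]
        refine Finset.sum_congr rfl fun i _ => by ring
      rw [this, hPP]
      simp [Matrix.one_apply, Fin.ext_iff]
    intro k
    rw [lower_trace]
    · refine Finset.sum_congr rfl fun i _ => ?_
      rw [key]; simp
    · intro i j hij
      have : (i : ℕ) < j := hij
      rw [key, if_neg (by omega), if_neg hij.ne]; simp

/-- The `2n` polynomial functions `x ↦ tr x^(i+1)` (`1 ≤ i ≤ n`) and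
`x ↦ tr Xʲ` (`1 ≤ j ≤ n`) on `sl(n+1, ℂ)` are algebraically independent over `ℂ`. -/
theorem statement18 (n : ℕ) (hn : 1 ≤ n) (Q : MvPolynomial (Fin n ⊕ Fin n) ℂ)
    (hQ : ∀ x : Matrix (Fin (n + 1)) (Fin (n + 1)) ℂ, x.trace = 0 →
      MvPolynomial.eval
        (Sum.elim (fun i : Fin n => (x ^ ((i : ℕ) + 2)).trace)
          (fun j : Fin n => (ulBlock n x ^ ((j : ℕ) + 1)).trace)) Q = 0) :
    Q = 0 := by
  refine MvPolynomial.funext fun v => ?_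
  rw [map_zero]
  obtain ⟨a, ha⟩ := exists_psum n fun k => if h : k - 1 < n then v (Sum.inr ⟨k - 1, h⟩) else 0
  obtain ⟨b, hb⟩ := exists_psum (n+1) fun k =>
    if k = 1 then 0 else if h : k - 2 < n then v (Sum.inl ⟨k - 2, h⟩) else 0
  obtain ⟨x, h1, h2⟩ := exists_matrix n a b
  have htr : x.trace = 0 := by
    have := h1 1
    rw [hb 1 one_pos (by omega)] at this
    simpa using this
  have := hQ x htr
  suffices hv : v = Sum.elim (fun i : Fin n => (x ^ ((i : ℕ) + 2)).trace)
      (fun j : Fin n => (ulBlock n x ^ ((j : ℕ) + 1)).trace) by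
    rw [hv]; exact this
  funext i
  rcases i with i | j
  · simp only [Sum.elim_inl]
    rw [h1, hb _ (by omega) (by omega)]
    simp
  · simp only [Sum.elim_inr]
    rw [h2, ha _ (by omega) (by omega)]
    simp
end
end
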